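/- For every convex hexagon P in the plane there exists a convex pentagon Q with P ⊆ Q and |Q| ≤ (7/6)·|P|. -/

import Mathlib

open MeasureTheory

/-- A convex `n`-gon in the plane: the convex hull of a finite set of at most `n` points,
having nonempty interior. -/
def IsConvexPolygon (n : ℕ) (Q : Set (ℝ × ℝ)) : Prop :=
  ∃ S : Finset (ℝ × ℝ), S.card ≤ n ∧ Q = convexHull ℝ (S : Set (ℝ × ℝ)) ∧
    (interior Q).Nonempty

lemma seven_add_sq_le (x y S : ℝ) (hx : 0 < x) (hy : 0 < y) (hx1 : x ≤ 1) (hy1 : y ≤ 1) (x' y' : ℝ)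
    (hxx : x * x' = 1) (hyy : y * y' = 1) (hS : 0 ≤ S) (hS2 : x ^ 2 + y ^ 2 - 1 ≤ S ^ 2) :
    7 + (x - y) ^ 2 / 4 ≤ S + x + y + 2 * x' + 2 * y' := by
  have hx' : x' = 1 / x := by field_simp; linarith
  have hy' : y' = 1 / y := by field_simp; linarith
  have hs0 : 0 < x + y := by positivity
  set s := x + y with hs
  have key : 8 / s + (x - y) ^ 2 ≤ 2 * x' + 2 * y' := by
    have h1 : 2 * x' + 2 * y' - 8 / s = 2 * (x - y) ^ 2 / (x * y * s) := by
      rw [hx', hy', hs]; field_simp; ring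
    have h2 : x * y * s ≤ 2 := by
      have : x * y ≤ 1 := by nlinarith
      have : s ≤ 2 := by linarith
      nlinarith [mul_pos hx hy]
    have h3 : (x - y) ^ 2 ≤ 2 * (x - y) ^ 2 / (x * y * s) := by
      rw [le_div_iff₀ (by positivity)]
      nlinarith [sq_nonneg (x - y)]
    linarith
  have h8 : 7 ≤ S + s + 8 / s := by
    by_contra hc
    push Not at hc
    have h0 : 8 / s * s = 8 := by field_simp
    set w := 8 / s with hw
    have hD : s ^ 2 / 2 - 1 ≤ S ^ 2 := by nlinarith [sq_nonneg (x - y)]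
    have h7 : 0 < 7 - s - w := by linarith
    have h71 : S ^ 2 < (7 - s - w) ^ 2 := by nlinarith
    have e1 : 0 < 7 * s - s ^ 2 - 8 := by nlinarith
    have e2 : (s ^ 2 / 2 - 1) * s ^ 2 < (7 * s - s ^ 2 - 8) ^ 2 := by
      have : (7 * s - s ^ 2 - 8) = (7 - s - w) * s := by linear_combination h0
      rw [this, mul_pow]
      have : 0 < s ^ 2 := by positivity
      nlinarith
    have hs2 : s ≤ 2 := by linarith
    have hs143 : 1.43 < s := by
      by_contra hh
      push Not at hh
      have := mul_nonneg (sub_nonneg.2 hh) (by linarith : (0 : ℝ) ≤ 5.57 - s)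
      linarith
    have e3 : s ^ 2 / 2 - 12 * s + 16 < 0 := by
      have := mul_nonneg (sub_nonneg.2 hs143.le) (sub_nonneg.2 hs2)
      linarith
    have e4 : (7 * s - s ^ 2 - 8) ^ 2 - (s ^ 2 / 2 - 1) * s ^ 2
        = (s - 2) ^ 2 * (s ^ 2 / 2 - 12 * s + 16) := by ring
    nlinarith [mul_nonneg (sq_nonneg (s - 2)) (neg_pos.2 e3).le]
  nlinarith [sq_nonneg (x - y)]

lemma nine_le_base (r u v r' u' v' S1 S2 S3 : ℝ) (hr : 0 < r) (hu : 0 < u)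
    (hv : 0 < v) (hrr : r * r' = 1) (huu : u * u' = 1) (hvv : v * v' = 1)
    (h1 : 0 ≤ S1) (h2 : 0 ≤ S2) (h3 : 0 ≤ S3)
    (d1 : r ^ 2 + u' ^ 2 - 1 ≤ S1 ^ 2) (d2 : u ^ 2 + v' ^ 2 - 1 ≤ S2 ^ 2)
    (d3 : v ^ 2 + r' ^ 2 - 1 ≤ S3 ^ 2) (r1 : r ≤ 1) (u1 : 1 ≤ u) (v1 : 1 ≤ v) :
    9 ≤ S1 + S2 + S3 + r + r' + u + u' + v + v' := by
  have hu' : 0 < u' := by by_contra h; nlinarith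
  have hv' : 0 < v' := by by_contra h; nlinarith
  have hr' : 0 < r' := by by_contra h; nlinarith
  have u1' : u' ≤ 1 := by nlinarith
  have v1' : v' ≤ 1 := by nlinarith
  have r1' : 1 ≤ r' := by nlinarith
  have a1 := seven_add_sq_le r u' S1 hr hu' r1 u1' r' u hrr (by linarith) h1 d1
  have a2 : u - (1 - v') * u' ≤ S2 := by
    apply abs_le_of_sq_le_sq' _ h2 |>.2
    have e : (u - (1 - v') * u') ^ 2 = u ^ 2 - 2 * (1 - v') + (1 - v') ^ 2 * u' ^ 2 := by
      linear_combination (-2 * (1 - v')) * huu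
    have : u' ^ 2 ≤ 1 := by nlinarith
    nlinarith [sq_nonneg (1 - v')]
  have a3 : r' + (v - 1) * r ≤ S3 := by
    apply abs_le_of_sq_le_sq' _ h3 |>.2
    have : (r' + (v - 1) * r) ^ 2 = r' ^ 2 + 2 * (v - 1) + (v - 1) ^ 2 * r ^ 2 := by
      linear_combination 2 * (v - 1) * hrr
    have : r ^ 2 ≤ 1 := by nlinarith
    nlinarith [sq_nonneg (v - 1)]
  have a4 : 0 ≤ (v + v' - 2) - (1 - v') * u' + (v - 1) * r + (r - u') ^ 2 / 4 := by
    have e : (v + v' - 2) - (1 - v') * u' + (v - 1) * r + (r - u') ^ 2 / 4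
        = v' * ((v - 1 - (u' - r) / 2) ^ 2 + (v - 1) * ((u' - r) ^ 2 / 4 + (v - 1) * r)) := by
      linear_combination (-(v - 2 - u' + v * r - r + (r - u') ^ 2 / 4) ) * hvv
    rw [e]
    have : 0 ≤ v - 1 := by linarith
    positivity
  linarith

lemma mul_le_of_mixed {x y S : ℝ} (hS : 0 ≤ S)
    (hd : x ^ 2 + y ^ 2 - 1 ≤ S ^ 2) (hxy : (x ^ 2 - 1) * (y ^ 2 - 1) ≤ 0) : x * y ≤ S := by
  apply abs_le_of_sq_le_sq' _ hS |>.2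
  nlinarith

lemma two_le_add_inv {x y : ℝ} (hx : 0 < x) (h : x * y = 1) : 2 ≤ x + y := by
  have : 0 < y := by by_contra hy; nlinarith
  nlinarith [sq_nonneg (x - y)]

lemma three_le_cyclic {x y z : ℝ} (hx : 0 < x) (hy : 0 < y) (hz : 0 < z) (h : x * y * z = 1) :
    3 ≤ x + y + z := by
  by_contra hc
  push Not at hc
  have h1 : 27 * (x * y * z) ≤ (x + y + z) ^ 3 := by
    nlinarith [mul_nonneg hx.le (sq_nonneg (y - z)), mul_nonneg hy.le (sq_nonneg (x - z)),
      mul_nonneg hz.le (sq_nonneg (x - y)), mul_nonneg hx.le (sq_nonneg (x - y)),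
      mul_nonneg hy.le (sq_nonneg (x - y)), mul_nonneg hx.le (sq_nonneg (x - z)),
      mul_nonneg hz.le (sq_nonneg (x - z)), mul_nonneg hy.le (sq_nonneg (y - z)),
      mul_nonneg hz.le (sq_nonneg (y - z))]
  have h2 : (x + y + z) ^ 3 < 3 ^ 3 := by gcongr
  linarith

lemma nine_le_mixed (r u v r' u' v' S1 S2 S3 : ℝ) (hr : 0 < r) (hu : 0 < u)
    (hv : 0 < v) (hr' : 0 < r') (hu' : 0 < u') (hv' : 0 < v')
    (hrr : r * r' = 1) (huu : u * u' = 1) (hvv : v * v' = 1)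
    (h1 : 0 ≤ S1) (h2 : 0 ≤ S2) (h3 : 0 ≤ S3)
    (d1 : r ^ 2 + u' ^ 2 - 1 ≤ S1 ^ 2) (d2 : u ^ 2 + v' ^ 2 - 1 ≤ S2 ^ 2)
    (d3 : v ^ 2 + r' ^ 2 - 1 ≤ S3 ^ 2) (r1 : 1 ≤ r) (u1 : 1 ≤ u) (v1 : 1 ≤ v) :
    9 ≤ S1 + S2 + S3 + r + r' + u + u' + v + v' := by
  have key : ∀ {a b : ℝ}, 1 ≤ a → 0 < b → b ≤ 1 → (a ^ 2 - 1) * (b ^ 2 - 1) ≤ 0 := by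
    intro a b ha hb hb1
    apply mul_nonpos_of_nonneg_of_nonpos <;> nlinarith
  have r1' : r' ≤ 1 := by nlinarith
  have u1' : u' ≤ 1 := by nlinarith
  have v1' : v' ≤ 1 := by nlinarith
  have := mul_le_of_mixed h1 d1 (key r1 hu' u1')
  have := mul_le_of_mixed h2 d2 (key u1 hv' v1')
  have := mul_le_of_mixed h3 d3 (key v1 hr' r1')
  have := two_le_add_inv hr hrr
  have := two_le_add_inv hu huu
  have := two_le_add_inv hv hvv
  have := three_le_cyclic (mul_pos hr hu') (mul_pos hu hv') (mul_pos hv hr')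
    (by linear_combination u * u' * v * v' * hrr + v * v' * huu + hvv)
  linarith

lemma nine_le_of_two (r u v r' u' v' S1 S2 S3 : ℝ) (hr : 0 < r) (hu : 0 < u)
    (hv : 0 < v) (hr' : 0 < r') (hu' : 0 < u') (hv' : 0 < v')
    (hrr : r * r' = 1) (huu : u * u' = 1) (hvv : v * v' = 1)
    (h1 : 0 ≤ S1) (h2 : 0 ≤ S2) (h3 : 0 ≤ S3)
    (d1 : r ^ 2 + u' ^ 2 - 1 ≤ S1 ^ 2) (d2 : u ^ 2 + v' ^ 2 - 1 ≤ S2 ^ 2)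
    (d3 : v ^ 2 + r' ^ 2 - 1 ≤ S3 ^ 2) (u1 : 1 ≤ u) (v1 : 1 ≤ v) :
    9 ≤ S1 + S2 + S3 + r + r' + u + u' + v + v' := by
  rcases le_total r 1 with r1 | r1
  · exact nine_le_base r u v r' u' v' S1 S2 S3 hr hu hv hrr huu hvv h1 h2 h3 d1 d2 d3 r1 u1 v1
  · exact nine_le_mixed r u v r' u' v' S1 S2 S3 hr hu hv hr' hu' hv' hrr huu hvv h1 h2 h3
      d1 d2 d3 r1 u1 v1

lemma nine_le (r u v r' u' v' S1 S2 S3 : ℝ) (hr : 0 < r) (hu : 0 < u)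
    (hv : 0 < v) (hr' : 0 < r') (hu' : 0 < u') (hv' : 0 < v')
    (hrr : r * r' = 1) (huu : u * u' = 1) (hvv : v * v' = 1)
    (h1 : 0 ≤ S1) (h2 : 0 ≤ S2) (h3 : 0 ≤ S3)
    (d1 : r ^ 2 + u' ^ 2 - 1 ≤ S1 ^ 2) (d2 : u ^ 2 + v' ^ 2 - 1 ≤ S2 ^ 2)
    (d3 : v ^ 2 + r' ^ 2 - 1 ≤ S3 ^ 2) :
    9 ≤ S1 + S2 + S3 + r + r' + u + u' + v + v' := by
  have flip : ∀ {x y : ℝ}, 0 < x → x * y = 1 → x ≤ 1 → 1 ≤ y := by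
    intro x y hx hxy hx1
    by_contra hc
    nlinarith
  have A := nine_le_of_two r u v r' u' v' S1 S2 S3 hr hu hv hr' hu' hv' hrr huu hvv
    h1 h2 h3 d1 d2 d3
  have B := nine_le_of_two u v r u' v' r' S2 S3 S1 hu hv hr hu' hv' hr' huu hvv hrr
    h2 h3 h1 d2 d3 d1
  have C := nine_le_of_two v r u v' r' u' S3 S1 S2 hv hr hu hv' hr' hu' hvv hrr huu
    h3 h1 h2 d3 d1 d2
  have A' := nine_le_of_two v' u' r' v u r S2 S1 S3 hv' hu' hr' hv hu hr
    (by linarith) (by linarith) (by linarith) h2 h1 h3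
    (by linarith) (by linarith) (by linarith)
  have B' := nine_le_of_two u' r' v' u r v S1 S3 S2 hu' hr' hv' hu hr hv
    (by linarith) (by linarith) (by linarith) h1 h3 h2
    (by linarith) (by linarith) (by linarith)
  have C' := nine_le_of_two r' v' u' r v u S3 S2 S1 hr' hv' hu' hr hv hu
    (by linarith) (by linarith) (by linarith) h3 h2 h1
    (by linarith) (by linarith) (by linarith)
  rcases le_total r 1 with r1 | r1 <;> rcases le_total u 1 with u1 | u1 <;>
    rcases le_total v 1 with v1 | v1
  · linarith [A' (flip hu huu u1) (flip hr hrr r1)]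
  · linarith [A' (flip hu huu u1) (flip hr hrr r1)]
  · linarith [B' (flip hr hrr r1) (flip hv hvv v1)]
  · linarith [A u1 v1]
  · linarith [C' (flip hv hvv v1) (flip hu huu u1)]
  · linarith [B v1 r1]
  · linarith [C r1 u1]
  · linarith [A u1 v1]

lemma corner_weight_aux_small (i j : ℝ) (hi : 1.84 ≤ i) (hj : 1.306 ≤ j)
    (hN : i ^ 2 + j ^ 2 ≤ 16) :
    0 < 2 * i * j * (1 - 0.0926 - 0.1975 * (0.1852) * (i ^ 2 + j ^ 2)) + 1.68 * i
        + 0.612 * j - 6.8 - 0.0926 * (i ^ 2 + j ^ 2) := by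
  obtain ⟨x, hx, rfl⟩ : ∃ x, 0 ≤ x ∧ i = 1.84 + x := ⟨i - 1.84, by linarith, by ring⟩
  obtain ⟨y, hy, rfl⟩ : ∃ x, 0 ≤ x ∧ j = 1.306 + x := ⟨j - 1.306, by linarith, by ring⟩
  have hD := sub_nonneg.2 hN
  nlinarith [mul_nonneg hD hx, mul_nonneg hD hy, mul_nonneg (mul_nonneg hD hx) hy,
    mul_nonneg hx hy]

lemma corner_weight_aux_large (i j : ℝ) (hi : 1.84 ≤ i) (hj : 1.306 ≤ j)
    (hN : 16 ≤ i ^ 2 + j ^ 2) : 0 < 0.6 * i * j + 1.3073 * i + 0.239 * j - 6.8 := by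
  obtain ⟨x, hx, rfl⟩ : ∃ x, 0 ≤ x ∧ i = 1.84 + x := ⟨i - 1.84, by linarith, by ring⟩
  obtain ⟨y, hy, rfl⟩ : ∃ x, 0 ≤ x ∧ j = 1.306 + x := ⟨j - 1.306, by linarith, by ring⟩
  by_contra hc
  push Not at hc
  have hxy := mul_nonneg hx hy
  have h1 := mul_nonneg hx (by linarith : 0 ≤ 1.264 - x)
  have h2 := mul_nonneg hy (by linarith : 0 ≤ 1.967 - y)
  linarith

lemma corner_weight_p_le (p A B : ℝ) (hp : 0 < p) (hA : 1.84 * p ≤ A) (hB : 1.306 * p ≤ B)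
    (g : A ^ 2 + B ^ 2 - 1.68 * p * A - 0.612 * p * B + 7.7992 * p ^ 2 + 4 / 3 * p ≤ 5 / 9) :
    p ≤ 0.1852 := by
  have h1 := mul_nonneg (sub_nonneg.2 hA) hp.le
  have h2 := mul_nonneg (sub_nonneg.2 hB) hp.le
  nlinarith [sq_nonneg (A - 1.84 * p), sq_nonneg (B - 1.306 * p)]

lemma corner_weight_sq_le (p A B : ℝ) (hp : 0 < p) (hA : 1.84 * p ≤ A) (hB : 1.306 * p ≤ B)
    (g : A ^ 2 + B ^ 2 - 1.68 * p * A - 0.612 * p * B + 7.7992 * p ^ 2 + 4 / 3 * p ≤ 5 / 9) :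
    A ^ 2 + B ^ 2 ≤ 5 / 9 := by
  by_contra hc
  push Not at hc
  have h0 : 0 < 1.68 * A + 0.612 * B := by nlinarith
  have h1 : 4 / 3 < 1.68 * A + 0.612 * B - 7.7992 * p := by nlinarith
  have h2 : (1.68 * A + 0.612 * B) ^ 2 ≤ 3.2 * (A ^ 2 + B ^ 2) := by
    nlinarith [sq_nonneg (1.68 * B - 0.612 * A)]
  nlinarith

lemma corner_weight_pos_of_large (p A B : ℝ) (hp : 0 < p) (hA : 1.84 * p ≤ A)
    (hB : 1.306 * p ≤ B) (hp1 : p ≤ 0.1852)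
    (hn : 16 * p ^ 2 ≤ A ^ 2 + B ^ 2) (h9 : A ^ 2 + B ^ 2 ≤ 5 / 9) :
    0 < 2 * A * B * (1 - p / 2 - 1.25 * (1 - 0.8 * p) * (A ^ 2 + B ^ 2))
      + 1.68 * p * A + 0.612 * p * B - 6.8 * p ^ 2 - p / 2 * (A ^ 2 + B ^ 2) := by
  have hL : 0.3 ≤ 1 - p / 2 - 1.25 * (1 - 0.8 * p) * (A ^ 2 + B ^ 2) := by nlinarith
  have hAp : 0 < A := by nlinarith
  have hBp : 0 < B := by nlinarith
  have hs : A ^ 2 + B ^ 2 ≤ 0.7454 * (A + B) := by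
    have : A ≤ 0.7454 := by nlinarith
    have : B ≤ 0.7454 := by nlinarith
    nlinarith
  have : 0 < 0.6 * A * B + 1.3073 * A * p + 0.239 * B * p - 6.8 * p ^ 2 := by
    obtain ⟨i, rfl⟩ : ∃ i, A = p * i := ⟨A / p, by field_simp⟩
    obtain ⟨j, rfl⟩ : ∃ j, B = p * j := ⟨B / p, by field_simp⟩
    have hi : 1.84 ≤ i := by nlinarith
    have hj : 1.306 ≤ j := by nlinarith
    have hN : 16 ≤ i ^ 2 + j ^ 2 := by
      have : p ^ 2 * 16 ≤ p ^ 2 * (i ^ 2 + j ^ 2) := by linarith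
      exact le_of_mul_le_mul_left this (by positivity)
    have := mul_pos (pow_pos hp 2) (corner_weight_aux_large i j hi hj hN)
    linarith
  have h3 := mul_le_mul_of_nonneg_left hL (mul_pos hAp hBp).le
  have h4 := mul_le_mul_of_nonneg_left hs hp.le
  have h5 := mul_pos hBp hp
  linarith

lemma corner_weight_pos_of_small (p A B : ℝ) (hp : 0 < p) (hA : 1.84 * p ≤ A)
    (hB : 1.306 * p ≤ B) (hp1 : p ≤ 0.1852) (hn : A ^ 2 + B ^ 2 ≤ 16 * p ^ 2) :
    0 < 2 * A * B * (1 - p / 2 - 1.25 * (1 - 0.8 * p) * (A ^ 2 + B ^ 2))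
      + 1.68 * p * A + 0.612 * p * B - 6.8 * p ^ 2 - p / 2 * (A ^ 2 + B ^ 2) := by
  obtain ⟨i, rfl⟩ : ∃ i, A = p * i := ⟨A / p, by field_simp⟩
  obtain ⟨j, rfl⟩ : ∃ j, B = p * j := ⟨B / p, by field_simp⟩
  have hi : 1.84 ≤ i := by nlinarith
  have hj : 1.306 ≤ j := by nlinarith
  have hN : i ^ 2 + j ^ 2 ≤ 16 := by
    have : p ^ 2 * (i ^ 2 + j ^ 2) ≤ p ^ 2 * 16 := by linarith
    exact le_of_mul_le_mul_left this (by positivity)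
  have hi0 : 0 < i := by linarith
  have hj0 : 0 < j := by linarith
  have e := corner_weight_aux_small i j hi hj hN
  have hc : (1 - 0.8 * p) * p ^ 2 ≤ 0.158 * p := by
    have : p * (1 - 0.8 * p) ≤ 0.158 := by nlinarith
    nlinarith
  have key : 0 < 2 * i * j * (1 - p / 2 - 0.1975 * p * (i ^ 2 + j ^ 2)) + 1.68 * i + 0.612 * j
      - 6.8 - p / 2 * (i ^ 2 + j ^ 2) := by
    have : 0 ≤ (0.1852 - p) * (i * j + 0.395 * (i * j) * (i ^ 2 + j ^ 2)
        + (i ^ 2 + j ^ 2) / 2) := mul_nonneg (by linarith) (by positivity)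
    linarith
  have h1 : (1 - 0.8 * p) * p ^ 2 * (p ^ 2 * (i * j * (i ^ 2 + j ^ 2)))
      ≤ 0.158 * p * (p ^ 2 * (i * j * (i ^ 2 + j ^ 2))) :=
    mul_le_mul_of_nonneg_right hc (by positivity)
  have h2 := mul_pos (pow_pos hp 2) key
  linarith

lemma corner_weight_pos (p A B : ℝ) (hp : 0 < p) (hA : 1.84 * p ≤ A) (hB : 1.306 * p ≤ B)
    (g : A ^ 2 + B ^ 2 - 1.68 * p * A - 0.612 * p * B + 7.7992 * p ^ 2 + 4 / 3 * p ≤ 5 / 9) :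
    0 < 2 * A * B * (1 - p / 2 - 1.25 * (1 - 0.8 * p) * (A ^ 2 + B ^ 2))
      + 1.68 * p * A + 0.612 * p * B - 6.8 * p ^ 2 - p / 2 * (A ^ 2 + B ^ 2) := by
  have hp1 := corner_weight_p_le p A B hp hA hB g
  rcases le_total (A ^ 2 + B ^ 2) (16 * p ^ 2) with hn | hn
  · exact corner_weight_pos_of_small p A B hp hA hB hp1 hn
  · exact corner_weight_pos_of_large p A B hp hA hB hp1 hn (corner_weight_sq_le p A B hp hA hB g)

lemma sq_le_mul_of_add_le {x s t : ℝ} (hs : 0 ≤ s) (ht : 0 ≤ t) (h : s + t ≤ 0.888 * x) :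
    (x - 0.75 * (s + t)) ^ 2 ≤ (x - s) * (x - t) := by
  nlinarith [mul_nonneg (add_nonneg hs ht) (sub_nonneg.2 h), mul_nonneg hs ht]

lemma two_mul_le_of_sq_le_mul {A B a b w s t : ℝ} (hs : 0 ≤ s) (ht : 0 ≤ t)
    (h : w ^ 2 ≤ s * t) :
    2 * (A * B * w) * (a * b) ≤ A ^ 2 * s * b ^ 2 + B ^ 2 * t * a ^ 2 := by
  apply abs_le_of_sq_le_sq' _ (by positivity) |>.2
  have h1 : (A * B * (a * b)) ^ 2 * w ^ 2 ≤ (A * B * (a * b)) ^ 2 * (s * t) :=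
    mul_le_mul_of_nonneg_left h (sq_nonneg _)
  linarith [sq_nonneg (A ^ 2 * s * b ^ 2 - B ^ 2 * t * a ^ 2)]

lemma corner_form_pos (p A B a b : ℝ) (hp : 0 < p) (hA : 1.84 * p ≤ A) (hB : 1.306 * p ≤ B)
    (g : A ^ 2 + B ^ 2 - 1.68 * p * A - 0.612 * p * B + 7.7992 * p ^ 2 + 4 / 3 * p ≤ 5 / 9)
    (ha : 0 < a) (hb : 0 < b) (hab : a + b = 1 + p / 2) :
    0 < A ^ 2 * b + B ^ 2 * a - A ^ 2 * B ^ 2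
      - (A ^ 2 + B ^ 2 - 1.68 * p * A - 0.612 * p * B + 6.8 * p ^ 2) * (a * b) := by
  have hT := corner_weight_pos p A B hp hA hB g
  have hn := corner_weight_sq_le p A B hp hA hB g
  have hp1 := corner_weight_p_le p A B hp hA hB g
  have hA0 : 0 ≤ A := by linarith
  have hB0 : 0 ≤ B := by linarith
  have hc : 1 ≤ (1 - 0.8 * p) * (a + b) ^ 2 := by
    rw [hab]
    have : 0 ≤ p * (0.2 - 0.55 * p - 0.2 * p ^ 2) := mul_nonneg hp.le (by nlinarith only [hp, hp1])
    linarith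
  have hc0 : 0 ≤ 1 - 0.8 * p := by linarith
  have hab0 := mul_pos ha hb
  have hcl : 1 - 0.8 * p ≤ 1 := by linarith
  generalize 1 - 0.8 * p = c at *
  have hcn : c * B ^ 2 + c * A ^ 2 ≤ 0.888 * (1 - p / 2) := by
    have := mul_le_of_le_one_left (by positivity : 0 ≤ A ^ 2 + B ^ 2) hcl
    linarith
  have hsB : 0 ≤ c * B ^ 2 := by positivity
  have hsA : 0 ≤ c * A ^ 2 := by positivity
  have hw := sq_le_mul_of_add_le hsB hsA hcn
  have hq := two_mul_le_of_sq_le_mul (A := A) (B := B) (a := a) (b := b) (by linarith)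
    (by linarith) hw
  have e1 : A ^ 2 * b ^ 2 + A ^ 2 * (a * b) - p / 2 * A ^ 2 * (a * b + b ^ 2) ≤ A ^ 2 * b := by
    have : A ^ 2 * b = A ^ 2 * b ^ 2 + A ^ 2 * (a * b) - p / 2 * A ^ 2 * b := by
      linear_combination (-A ^ 2 * b) * hab
    have h2 : b ≤ a * b + b ^ 2 := by
      linarith [mul_pos hb hp, (by rw [← hab]; ring : b * (1 + p / 2) = a * b + b ^ 2)]
    have := mul_le_mul_of_nonneg_left h2 (by positivity : 0 ≤ p / 2 * A ^ 2)
    linarith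
  have e2 : B ^ 2 * a ^ 2 + B ^ 2 * (a * b) - p / 2 * B ^ 2 * (a * b + a ^ 2) ≤ B ^ 2 * a := by
    have : B ^ 2 * a = B ^ 2 * a ^ 2 + B ^ 2 * (a * b) - p / 2 * B ^ 2 * a := by
      linear_combination (-B ^ 2 * a) * hab
    have h2 : a ≤ a * b + a ^ 2 := by
      linarith [mul_pos ha hp, (by rw [← hab]; ring : a * (1 + p / 2) = a * b + a ^ 2)]
    have := mul_le_mul_of_nonneg_left h2 (by positivity : 0 ≤ p / 2 * B ^ 2)
    linarith
  have e3 : A ^ 2 * B ^ 2 ≤ A ^ 2 * B ^ 2 * (c * (a + b) ^ 2) :=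
    le_mul_of_one_le_right (by positivity) hc
  have e4 : 0 ≤ c * (A * B) * (A - B) ^ 2 * (a * b) := by positivity
  have e5 := mul_pos hT hab0
  linarith

lemma one_sub_mul_le_of_flat {p α β Y Z : ℝ} (hp : 0 < p) (hα : p < α) (hβ : p < β)
    (hM : α ^ 2 + β ^ 2 + 6 * p ^ 2 < 5 / 9 - 4 / 3 * p - p ^ 2) (hY : 0.8 * (α + p) ≤ Y)
    (hZ : 0.8 * β ≤ Z) (hY1 : Y ≤ 1) (hZ1 : Z ≤ 1) :
    (1 - Y) * (1 - Z) < 1 - (α ^ 2 + β ^ 2 + 6 * p ^ 2) := by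
  have h1 : (1 - Y) * (1 - Z) ≤ (1 - 0.8 * (α + p)) * (1 - 0.8 * β) := by
    apply mul_le_mul <;> linarith
  have hp1 : p ≤ 0.1852 := by
    nlinarith only [hM, hp, mul_pos hp (sub_pos.2 hα), mul_pos hp (sub_pos.2 hβ),
      sq_nonneg (α - p), sq_nonneg (β - p)]
  have hs : (α + β) ^ 2 ≤ 2 * (5 / 9 - 4 / 3 * p - 7 * p ^ 2) := by
    nlinarith only [hM, sq_nonneg (α - β)]
  have h2 : 0 < 0.8 * (α + p) + 0.8 * β - 0.64 * (α + p) * β - (α ^ 2 + β ^ 2 + 6 * p ^ 2) := by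
    have hβ1 : β ≤ 0.746 := by
      apply (abs_le_of_sq_le_sq' _ _).2
      · nlinarith only [hM, sq_nonneg α, sq_nonneg p, hp]
      · norm_num
    have h3 := mul_le_mul_of_nonneg_left hβ1 hp.le
    have h4 := mul_pos (sub_pos.2 hα) (sub_pos.2 hβ)
    rcases le_total (α + β) 0.65 with h5 | h5
    · have h6 := mul_nonneg (sub_nonneg.2 h5) (by linarith : 0 ≤ α + β - 2 * p)
      have h7 := mul_nonneg hp.le (sub_nonneg.2 hp1)
      nlinarith only [h3, h4, h6, h7, hp, hα, hβ]
    · have h8 : α + β ≤ 1.1 := by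
        apply (abs_le_of_sq_le_sq' _ _).2
        · nlinarith only [hs, sq_nonneg p, hp]
        · norm_num
      have h6 := mul_nonneg (sub_nonneg.2 h5) (sub_nonneg.2 h8)
      have h7 := mul_nonneg hp.le (sub_nonneg.2 hp1)
      linarith
  linarith

lemma corner_false_of_steep {p α β r u r' u' Y Z : ℝ} (hp : 0 < p) (hα : p < α) (hβ : p < β)
    (hM : α ^ 2 + β ^ 2 + 6 * p ^ 2 < 5 / 9 - 4 / 3 * p - p ^ 2)
    (hr : 0 < r) (hu' : 0 < u') (hrr : r * r' = 1) (huu : u * u' = 1)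
    (hY : Y = (α + p) * r') (hZ : Z = β * u) (hY1 : Y < 1) (hZ1 : Z < 1)
    (hc : 1 - (α ^ 2 + β ^ 2 + 6 * p ^ 2) ≤ (1 - Y) * (1 - Z))
    (h : (α + 0.707 * p) * r + (β + 0.707 * p) * u' ≤ 1 + p / 2) : False := by
  set a := (α + 0.707 * p) * r with ha
  have ha0 : 0 < a := mul_pos (by linarith) hr
  have hb0 : 0 < (β + 0.707 * p) * u' := mul_pos (by linarith) hu'
  obtain ⟨b, hb⟩ : ∃ b, b = 1 + p / 2 - a := ⟨_, rfl⟩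
  have hYa : (α + 0.84 * p) ^ 2 ≤ Y * a := by
    have : Y * a = (α + p) * (α + 0.707 * p) := by
      rw [hY, ha]; linear_combination ((α + p) * (α + 0.707 * p)) * hrr
    rw [this]
    nlinarith only [mul_pos hp (sub_pos.2 hα), mul_pos hp hp]
  have hZb : (β + 0.306 * p) ^ 2 ≤ Z * b := by
    have h1 : Z * ((β + 0.707 * p) * u') = β * (β + 0.707 * p) := by
      rw [hZ]; linear_combination (β * (β + 0.707 * p)) * huu
    have hZ0 : 0 ≤ Z := by
      by_contra hn
      have : 0 < Z * ((β + 0.707 * p) * u') := by rw [h1]; apply mul_pos <;> linarith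
      exact absurd this (not_lt.2 (mul_nonpos_of_nonpos_of_nonneg (not_le.1 hn).le hb0.le))
    have h2 : Z * ((β + 0.707 * p) * u') ≤ Z * b := mul_le_mul_of_nonneg_left (by linarith) hZ0
    rw [h1] at h2
    refine le_trans ?_ h2
    nlinarith only [mul_pos hp (sub_pos.2 hβ), mul_pos hp hp]
  have hbp : 0 < b := by linarith
  have hF := corner_form_pos p (α + 0.84 * p) (β + 0.306 * p) a b hp (by linarith) (by linarith)
    (by linarith [sq_nonneg p]) ha0 hbp (by linarith)
  have h3 := mul_le_mul_of_nonneg_right hc (mul_pos ha0 hbp).le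
  have h4 : (a - Y * a) * (b - Z * b) ≤ (a - (α + 0.84 * p) ^ 2) * (b - (β + 0.306 * p) ^ 2) := by
    apply mul_le_mul
    · linarith
    · linarith
    · linarith [mul_pos hbp (sub_pos.2 hZ1)]
    · linarith [mul_pos ha0 (sub_pos.2 hY1)]
  have h5 : 0 ≤ p ^ 2 * (a * b) := by positivity
  linarith

lemma corner_false {p α β γ r u v r' u' v' S1 S2 S3 : ℝ} (hp : 0 < p) (hα : p < α) (hβ : p < β)
    (hγ : p + 2 / 3 < γ)
    (hr : 0 < r) (hu : 0 < u) (hr' : 0 < r') (hu' : 0 < u') (hv' : 0 < v')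
    (hrr : r * r' = 1) (huu : u * u' = 1) (hvv : v * v' = 1)
    (h1 : 0 ≤ S1) (h2 : 0 ≤ S2) (h3 : 0 ≤ S3)
    (d1 : r ^ 2 + u' ^ 2 - 1 ≤ S1 ^ 2) (d3 : v ^ 2 + r' ^ 2 - 1 ≤ S3 ^ 2)
    (e1 : α * r + β * u' + p * S1 ≤ 1) (e2 : β * u + γ * v' + p * S2 ≤ 1)
    (e3 : γ * v + α * r' + p * S3 ≤ 1)
    (hW : α ^ 2 + β ^ 2 + γ ^ 2 + 6 * p ^ 2 = 1) (hv : 1 ≤ v) : False := by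
  have hS3 : r' ≤ S3 := by
    apply (abs_le_of_sq_le_sq' _ h3).2
    nlinarith only [d3, hv]
  have hα0 : 0 < α := by linarith
  have hβ0 : 0 < β := by linarith
  have hγ0 : 0 < γ := by linarith
  have hY : γ * v ≤ 1 - (α + p) * r' := by linarith [mul_le_mul_of_nonneg_left hS3 hp.le]
  have hZ : γ * v' ≤ 1 - β * u := by linarith [mul_nonneg hp.le h2]
  have hM : α ^ 2 + β ^ 2 + 6 * p ^ 2 < 5 / 9 - 4 / 3 * p - p ^ 2 := by
    nlinarith only [hγ, hp, hW]
  have hc : 1 - (α ^ 2 + β ^ 2 + 6 * p ^ 2) ≤ (1 - (α + p) * r') * (1 - β * u) := by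
    have h4 := mul_le_mul hY hZ (by positivity) ((by positivity : 0 ≤ γ * v).trans hY)
    have h5 : γ * v * (γ * v') = γ ^ 2 := by linear_combination γ ^ 2 * hvv
    linarith
  have hY1 : (α + p) * r' < 1 := by linarith [mul_pos hγ0 (by linarith : 0 < v)]
  have hZ1 : β * u < 1 := by linarith [mul_pos hγ0 hv']
  rcases lt_or_ge (r ^ 2 + u' ^ 2) (25 / 16) with hs | hs
  · have hr1 : r < 5 / 4 := by nlinarith only [hs, sq_nonneg u']
    have hu1 : u' < 5 / 4 := by nlinarith only [hs, sq_nonneg r]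
    have hr2 : 0.8 ≤ r' := by nlinarith only [hr1, hrr, hr']
    have hu2 : 0.8 ≤ u := by nlinarith only [hu1, huu, hu]
    exact absurd hc (not_le.2 (one_sub_mul_le_of_flat hp hα hβ hM
      (by nlinarith only [hr2, hα0, hp]) (by nlinarith only [hu2, hβ0])
      hY1.le hZ1.le))
  · have hS1 : 0.707 * (r + u') - 1 / 2 ≤ S1 := by
      obtain ⟨s, hs0, hss⟩ : ∃ s, 0 ≤ s ∧ s ^ 2 = r ^ 2 + u' ^ 2 :=
        ⟨_, Real.sqrt_nonneg _, Real.sq_sqrt (by positivity)⟩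
      have hs1 : 5 / 4 ≤ s := by nlinarith only [hs, hss, hs0]
      have hs2 : 0.707 * (r + u') ≤ s := by
        apply (abs_le_of_sq_le_sq' _ hs0).2
        nlinarith only [sq_nonneg (r - u'), sq_nonneg (r + u'), hss]
      have hs3 : s - 1 / 2 ≤ S1 := by
        apply (abs_le_of_sq_le_sq' _ h1).2
        linarith
      linarith
    refine corner_false_of_steep hp hα hβ hM hr hu' hrr huu rfl rfl hY1 hZ1 hc ?_
    linarith [mul_le_mul_of_nonneg_left hS1 hp.le]

lemma corner_le {p α β γ r u v r' u' v' S1 S2 S3 : ℝ} (hp : 0 < p) (hα : p < α) (hβ : p < β)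
    (hr : 0 < r) (hu : 0 < u) (hv : 0 < v) (hr' : 0 < r') (hu' : 0 < u') (hv' : 0 < v')
    (hrr : r * r' = 1) (huu : u * u' = 1) (hvv : v * v' = 1)
    (h1 : 0 ≤ S1) (h2 : 0 ≤ S2) (h3 : 0 ≤ S3)
    (d1 : r ^ 2 + u' ^ 2 - 1 ≤ S1 ^ 2) (d2 : u ^ 2 + v' ^ 2 - 1 ≤ S2 ^ 2)
    (d3 : v ^ 2 + r' ^ 2 - 1 ≤ S3 ^ 2)
    (e1 : α * r + β * u' + p * S1 ≤ 1) (e2 : β * u + γ * v' + p * S2 ≤ 1)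
    (e3 : γ * v + α * r' + p * S3 ≤ 1)
    (hW : α ^ 2 + β ^ 2 + γ ^ 2 + 6 * p ^ 2 = 1) : γ ≤ p + 2 / 3 := by
  by_contra hγ
  push Not at hγ
  rcases le_total 1 v with hv1 | hv1
  · exact corner_false hp hα hβ hγ hr hu hr' hu' hv' hrr huu hvv h1 h2 h3 d1 d3 e1 e2 e3 hW hv1
  · exact corner_false (r := u') (u := r') (v := v') (r' := u) (u' := r) (v' := v)
      (S1 := S1) (S2 := S3) (S3 := S2) hp hβ hα hγ hu' hr' hu hr hv
      (by linarith) (by linarith) (by linarith) h1 h3 h2 (by linarith) (by linarith)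
      (by linarith) (by linarith) (by linarith) (by linarith) (by nlinarith only [hv, hvv, hv1])

lemma triangle_false {p α β γ r u v r' u' v' S1 S2 S3 : ℝ} (hp : 0 < p) (hα : p < α)
    (hβ : p < β) (hγ : p < γ)
    (hr : 0 < r) (hu : 0 < u) (hv : 0 < v) (hr' : 0 < r') (hu' : 0 < u') (hv' : 0 < v')
    (hrr : r * r' = 1) (huu : u * u' = 1) (hvv : v * v' = 1)
    (h1 : 0 ≤ S1) (h2 : 0 ≤ S2) (h3 : 0 ≤ S3)
    (d1 : r ^ 2 + u' ^ 2 - 1 ≤ S1 ^ 2) (d2 : u ^ 2 + v' ^ 2 - 1 ≤ S2 ^ 2)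
    (d3 : v ^ 2 + r' ^ 2 - 1 ≤ S3 ^ 2)
    (e1 : α * r + β * u' + p * S1 ≤ 1) (e2 : β * u + γ * v' + p * S2 ≤ 1)
    (e3 : γ * v + α * r' + p * S3 ≤ 1)
    (hW : α ^ 2 + β ^ 2 + γ ^ 2 + 6 * p ^ 2 = 1) : False := by
  have c3 := corner_le hp hα hβ hr hu hv hr' hu' hv' hrr huu hvv h1 h2 h3 d1 d2 d3 e1 e2 e3 hW
  have c1 := corner_le hp hβ hγ hu hv hr hu' hv' hr' huu hvv hrr h2 h3 h1 d2 d3 d1 e2 e3 e1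
    (by linarith)
  have c2 := corner_le hp hγ hα hv hr hu hv' hr' hu' hvv hrr huu h3 h1 h2 d3 d1 d2 e3 e1 e2
    (by linarith)
  have h9 := nine_le r u v r' u' v' S1 S2 S3 hr hu hv hr' hu' hv' hrr huu hvv h1 h2 h3 d1 d2 d3
  obtain ⟨x, rfl⟩ : ∃ x, α = p + x := ⟨α - p, by ring⟩
  obtain ⟨y, rfl⟩ : ∃ x, β = p + x := ⟨β - p, by ring⟩
  obtain ⟨z, rfl⟩ : ∃ x, γ = p + x := ⟨γ - p, by ring⟩
  have hx : 0 < x := by linarith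
  have hy : 0 < y := by linarith
  have hz : 0 < z := by linarith
  have f1 := mul_le_mul_of_nonneg_left (two_le_add_inv hr hrr) hx.le
  have f2 := mul_le_mul_of_nonneg_left (two_le_add_inv hu huu) hy.le
  have f3 := mul_le_mul_of_nonneg_left (two_le_add_inv hv hvv) hz.le
  have f4 := mul_le_mul_of_nonneg_left h9 hp.le
  have hs : x + y + z ≤ (3 - 9 * p) / 2 := by linarith
  have g0 := mul_le_mul_of_nonneg_left hs (by linarith : 0 ≤ 2 * p + 2 / 3)
  have g1 := mul_nonneg hx.le (by linarith : 0 ≤ 2 / 3 - x)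
  have g2 := mul_nonneg hy.le (by linarith : 0 ≤ 2 / 3 - y)
  have g3 := mul_nonneg hz.le (by linarith : 0 ≤ 2 / 3 - z)
  have k : ∀ {t : ℝ}, 0 < t → t * (2 / 3 - t) ≤ 0 → 2 / 3 ≤ t := by
    intro t ht h
    by_contra hc
    linarith [mul_pos ht (by linarith : 0 < 2 / 3 - t)]
  have k1 := k hx (by linarith)
  have k2 := k hy (by linarith)
  have k3 := k hz (by linarith)
  linarith

lemma exists_mul_inv_of_pos {a a' : ℝ} (ha : 0 < a) (ha' : 0 < a') :
    ∃ α r r' : ℝ, 0 < α ∧ 0 < r ∧ 0 < r' ∧ r * r' = 1 ∧ a = α * r ∧ a' = α * r' := by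
  have h : √a * √a = a := Real.mul_self_sqrt ha.le
  have h' : √a' * √a' = a' := Real.mul_self_sqrt ha'.le
  have hp := Real.sqrt_pos.2 ha
  have hp' := Real.sqrt_pos.2 ha'
  refine ⟨√a * √a', √a / √a', √a' / √a, by positivity, by positivity, by positivity, ?_, ?_, ?_⟩
  · field_simp
  · field_simp
    linarith
  · field_simp
    linarith

lemma sections_false {a a' b b' c c' s1 s2 s3 q : ℝ} (ha : 0 < a) (ha' : 0 < a') (hb : 0 < b)
    (hb' : 0 < b') (hc : 0 < c) (hc' : 0 < c') (hs1 : 0 < s1) (hs2 : 0 < s2) (hs3 : 0 < s3)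
    (hq : 0 < q) (e1 : a + b' + s1 = 1) (e2 : b + c' + s2 = 1) (e3 : c + a' + s3 = 1)
    (hW : 6 * q = 1 - a * a' - b * b' - c * c')
    (qa : q < a * a') (qb : q < b * b') (qc : q < c * c')
    (d1 : q * (a' * b' - a' * b + a * b) < a' * b * s1 ^ 2)
    (d2 : q * (b' * c' - b' * c + b * c) < b' * c * s2 ^ 2)
    (d3 : q * (c' * a' - c' * a + c * a) < c' * a * s3 ^ 2) : False := by
  obtain ⟨α, r, r', hα, hr, hr', hrr, rfl, rfl⟩ := exists_mul_inv_of_pos ha ha'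
  obtain ⟨β, u, u', hβ, hu, hu', huu, rfl, rfl⟩ := exists_mul_inv_of_pos hb hb'
  obtain ⟨γ, v, v', hγ, hv, hv', hvv, rfl, rfl⟩ := exists_mul_inv_of_pos hc hc'
  obtain ⟨p, hp, rfl⟩ : ∃ p, 0 < p ∧ p ^ 2 = q := ⟨√q, Real.sqrt_pos.2 hq, Real.sq_sqrt hq.le⟩
  have kk : ∀ {α r r' : ℝ}, 0 < α → r * r' = 1 → p ^ 2 < α * r * (α * r') → p < α := by
    intro α r r' hα h h1
    apply lt_of_pow_lt_pow_left₀ 2 hα.le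
    have : α * r * (α * r') = α ^ 2 := by linear_combination α ^ 2 * h
    linarith
  have key : ∀ {α β r r' u u' s : ℝ}, 0 < α → 0 < β → 0 < r → 0 < r' → 0 < u → 0 < u' →
      r * r' = 1 → u * u' = 1 →
      p ^ 2 * (α * r' * (β * u') - α * r' * (β * u) + α * r * (β * u))
        < α * r' * (β * u) * s ^ 2 → r ^ 2 + u' ^ 2 - 1 ≤ (s / p) ^ 2 := by
    intro α β r r' u u' s hα hβ hr hr' hu hu' h h' h1
    rw [div_pow, le_div_iff₀ (by positivity)]
    have h2 : α * r' * (β * u) * ((r ^ 2 + u' ^ 2 - 1) * p ^ 2) < α * r' * (β * u) * s ^ 2 := by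
      have : α * r' * (β * u) * ((r ^ 2 + u' ^ 2 - 1) * p ^ 2) =
          p ^ 2 * (α * r' * (β * u') - α * r' * (β * u) + α * r * (β * u)) := by
        linear_combination p ^ 2 * α * β * r * u * h + p ^ 2 * α * β * r' * u' * h'
      linarith
    exact (lt_of_mul_lt_mul_left h2 (by positivity)).le
  have hα2 : α * r * (α * r') = α ^ 2 := by linear_combination α ^ 2 * hrr
  have hβ2 : β * u * (β * u') = β ^ 2 := by linear_combination β ^ 2 * huu
  have hγ2 : γ * v * (γ * v') = γ ^ 2 := by linear_combination γ ^ 2 * hvv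
  have hps : ∀ s : ℝ, p * (s / p) = s := fun s => by field_simp
  exact triangle_false (S1 := s1 / p) (S2 := s2 / p) (S3 := s3 / p) hp (kk hα hrr qa)
    (kk hβ huu qb) (kk hγ hvv qc) hr hu hv hr' hu' hv' hrr huu hvv
    (by positivity) (by positivity) (by positivity) (key hα hβ hr hr' hu hu' hrr huu d1)
    (key hβ hγ hu hu' hv hv' huu hvv d2) (key hγ hα hv hv' hr hr' hvv hrr d3)
    (by rw [hps]; linarith) (by rw [hps]; linarith) (by rw [hps]; linarith) (by linarith)

lemma alternating_false {k0 k1 k2 k3 k4 k5 c0 c1 c2 c3 c4 c5 M W : ℝ}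
    (k0_pos : 0 < k0) (k2_pos : 0 < k2) (k4_pos : 0 < k4) (c0_pos : 0 < c0) (c1_pos : 0 < c1)
    (c2_pos : 0 < c2) (c3_pos : 0 < c3) (c4_pos : 0 < c4) (c5_pos : 0 < c5) (hW : 0 < W)
    (r1 : k1 * (k0 * k2) = c1 * c3 * k0 - c1 * c2 * k4 + c0 * c2 * k2)
    (r3 : k3 * (k2 * k4) = c3 * c5 * k2 - c3 * c4 * k0 + c2 * c4 * k4)
    (r5 : k5 * (k4 * k0) = c5 * c1 * k4 - c5 * c0 * k2 + c4 * c0 * k0)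
    (m1 : k0 * k2 + c0 * k2 + c3 * k0 = M) (m2 : k2 * k4 + c2 * k4 + c5 * k2 = M)
    (m3 : k4 * k0 + c4 * k0 + c1 * k4 = M)
    (w : W * (k0 * k2 * k4) = M ^ 2 - c0 * c1 * (k2 * k4) - c2 * c3 * (k4 * k0)
      - c4 * c5 * (k0 * k2))
    (h0 : k0 * W < 6 * (c0 * c1)) (h1 : k1 * W < 6 * (c1 * c2)) (h2 : k2 * W < 6 * (c2 * c3))
    (h3 : k3 * W < 6 * (c3 * c4)) (h4 : k4 * W < 6 * (c4 * c5)) (h5 : k5 * W < 6 * (c5 * c0)) :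
    False := by
  have hM : 0 < M := by rw [← m1]; positivity
  have odd : ∀ {k0 k1 k2 k4 c0 c1 c2 c3 : ℝ}, 0 < k0 → 0 < k2 → 0 < k4 →
      k1 * (k0 * k2) = c1 * c3 * k0 - c1 * c2 * k4 + c0 * c2 * k2 → k1 * W < 6 * (c1 * c2) →
      W * (k0 * k2 * k4) / (6 * M ^ 2) * (c1 * k4 / M * (c3 * k0 / M) - c1 * k4 / M * (c2 * k4 / M)
        + c0 * k2 / M * (c2 * k4 / M)) < c1 * k4 / M * (c2 * k4 / M) * (k0 * k2 / M) ^ 2 := by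
    intro k0 k1 k2 k4 c0 c1 c2 c3 p0 p2 p4 r h
    have e1 : W * (k0 * k2 * k4) / (6 * M ^ 2) * (c1 * k4 / M * (c3 * k0 / M)
        - c1 * k4 / M * (c2 * k4 / M) + c0 * k2 / M * (c2 * k4 / M))
        = (k1 * W) * ((k0 * k2 * k4) ^ 2 / (6 * M ^ 4)) := by
      field_simp
      linear_combination -r
    have e2 : c1 * k4 / M * (c2 * k4 / M) * (k0 * k2 / M) ^ 2
        = (6 * (c1 * c2)) * ((k0 * k2 * k4) ^ 2 / (6 * M ^ 4)) := by
      field_simp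
    rw [e1, e2]
    exact mul_lt_mul_of_pos_right h (by positivity)
  have even : ∀ {k0 k2 k4 c0 c1 : ℝ}, 0 < k0 → 0 < k2 → 0 < k4 → k0 * W < 6 * (c0 * c1) →
      W * (k0 * k2 * k4) / (6 * M ^ 2) < c0 * k2 / M * (c1 * k4 / M) := by
    intro k0 k2 k4 c0 c1 p0 p2 p4 h
    have e1 : W * (k0 * k2 * k4) / (6 * M ^ 2) = (k0 * W) * (k2 * k4 / (6 * M ^ 2)) := by ring
    have e2 : c0 * k2 / M * (c1 * k4 / M) = (6 * (c0 * c1)) * (k2 * k4 / (6 * M ^ 2)) := by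
      field_simp
    rw [e1, e2]
    exact mul_lt_mul_of_pos_right h (by positivity)
  have rot1 : k2 * k4 * k0 = k0 * k2 * k4 := by ring
  have rot2 : k4 * k0 * k2 = k0 * k2 * k4 := by ring
  refine sections_false (a := c0 * k2 / M) (a' := c1 * k4 / M) (b := c2 * k4 / M)
    (b' := c3 * k0 / M) (c := c4 * k0 / M) (c' := c5 * k2 / M) (s1 := k0 * k2 / M)
    (s2 := k2 * k4 / M) (s3 := k4 * k0 / M) (q := W * (k0 * k2 * k4) / (6 * M ^ 2))
    (by positivity) (by positivity) (by positivity) (by positivity) (by positivity)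
    (by positivity) (by positivity) (by positivity) (by positivity) (by positivity)
    ?_ ?_ ?_ ?_ (even k0_pos k2_pos k4_pos h0) ?_ ?_ (odd k0_pos k2_pos k4_pos r1 h1) ?_ ?_
  · field_simp; linarith
  · field_simp; linarith
  · field_simp; linarith
  · field_simp; linarith
  · rw [← rot1]; exact even k2_pos k4_pos k0_pos h2
  · rw [← rot2]; exact even k4_pos k0_pos k2_pos h4
  · rw [← rot1]; exact odd k2_pos k4_pos k0_pos r3 h3
  · rw [← rot2]; exact odd k4_pos k0_pos k2_pos r5 h5

lemma area_relation {k0 k1 k2 k3 k4 k5 c0 c1 c2 c3 c4 c5 f0 f1 M W : ℝ}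
    (k0_pos : 0 < k0) (k2_pos : 0 < k2) (k4_pos : 0 < k4)
    (r1 : k1 * (k0 * k2) = c1 * c3 * k0 - c1 * c2 * k4 + c0 * c2 * k2)
    (r3 : k3 * (k2 * k4) = c3 * c5 * k2 - c3 * c4 * k0 + c2 * c4 * k4)
    (r5 : k5 * (k4 * k0) = c5 * c1 * k4 - c5 * c0 * k2 + c4 * c0 * k0)
    (hf0 : f0 * k0 = c0 * k2 - c1 * k4) (hf1 : f1 = c1 - c2 - k2 + k0)
    (m1 : k0 * k2 + c0 * k2 + c3 * k0 = M) (m2 : k2 * k4 + c2 * k4 + c5 * k2 = M)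
    (m3 : k4 * k0 + c4 * k0 + c1 * k4 = M)
    (hW : W = c1 + k1 + c2 + f0 + k2 + c3 - k5 + f1 + k3 + c4) :
    W * (k0 * k2 * k4) = M ^ 2 - c0 * c1 * (k2 * k4) - c2 * c3 * (k4 * k0)
      - c4 * c5 * (k0 * k2) := by
  obtain ⟨x0, rfl⟩ : ∃ x, c0 = k0 * x := ⟨c0 / k0, by field_simp⟩
  obtain ⟨x2, rfl⟩ : ∃ x, c2 = k2 * x := ⟨c2 / k2, by field_simp⟩
  obtain ⟨x4, rfl⟩ : ∃ x, c4 = k4 * x := ⟨c4 / k4, by field_simp⟩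
  obtain ⟨l, rfl⟩ : ∃ x, M = k0 * k2 * k4 * x := ⟨M / (k0 * k2 * k4), by field_simp⟩
  obtain rfl : c3 = k2 * (k4 * l - 1 - x0) := by
    apply mul_left_cancel₀ k0_pos.ne'; linear_combination m1
  obtain rfl : c5 = k4 * (k0 * l - 1 - x2) := by
    apply mul_left_cancel₀ k2_pos.ne'; linear_combination m2
  obtain rfl : c1 = k0 * (k2 * l - 1 - x4) := by
    apply mul_left_cancel₀ k4_pos.ne'; linear_combination m3
  rw [hW, hf1]
  linear_combination k4 * r1 + k0 * r3 - k2 * r5 + k2 * k4 * hf0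
def cross (u v : ℝ × ℝ) : ℝ := u.1 * v.2 - u.2 * v.1

lemma plucker (a b c d : ℝ × ℝ) :
    cross a c * cross b d = cross a b * cross c d + cross a d * cross b c := by
  simp only [cross]; ring

lemma cross_swap (a b : ℝ × ℝ) : cross b a = - cross a b := by
  simp only [cross]; ring

lemma alternating_relation (e0 e1 e2 e3 e5 : ℝ × ℝ) :
    cross e0 e2 * (cross e5 e1 * cross e1 e3) = cross e0 e1 * cross e2 e3 * cross e5 e1
      - cross e0 e1 * cross e1 e2 * cross e3 e5 + cross e5 e0 * cross e1 e2 * cross e1 e3 := by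
  simp only [cross]; ring

lemma sum_relation {e0 e1 e2 e3 e4 e5 : ℝ × ℝ} (h : e0 + e1 + e2 + e3 + e4 + e5 = 0) :
    cross e5 e1 * cross e1 e3 + cross e5 e0 * cross e1 e3 + cross e2 e3 * cross e5 e1
    = cross e1 e3 * cross e3 e5 + cross e1 e2 * cross e3 e5 + cross e4 e5 * cross e1 e3 := by
  obtain rfl : e0 = -(e1 + e2 + e3 + e4 + e5) := by
    rw [eq_neg_iff_add_eq_zero, ← h]; abel
  simp only [cross, Prod.fst_neg, Prod.snd_neg, Prod.fst_add, Prod.snd_add]; ring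

/-- Edge vectors of a convex hexagon of doubled area `W`, every ear of which is larger than
one sixth of the area. -/
structure LargeEars (e0 e1 e2 e3 e4 e5 : ℝ × ℝ) (W : ℝ) : Prop where
  sum : e0 + e1 + e2 + e3 + e4 + e5 = 0
  area : W = cross e0 e1 + cross e0 e2 + cross e0 e3 + cross e0 e4 + cross e1 e2 + cross e1 e3
    + cross e1 e4 + cross e2 e3 + cross e2 e4 + cross e3 e4
  area_pos : 0 < W
  c0 : 0 < cross e5 e0
  c1 : 0 < cross e0 e1
  c2 : 0 < cross e1 e2
  c3 : 0 < cross e2 e3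
  c4 : 0 < cross e3 e4
  c5 : 0 < cross e4 e5
  l0 : 0 < cross e5 e0 + cross e5 e1
  l1 : 0 < cross e0 e1 + cross e0 e2
  l2 : 0 < cross e1 e2 + cross e1 e3
  l3 : 0 < cross e2 e3 + cross e2 e4
  l4 : 0 < cross e3 e4 + cross e3 e5
  l5 : 0 < cross e4 e5 + cross e4 e0
  r0 : 0 < cross e0 e1 + cross e5 e1
  r1 : 0 < cross e1 e2 + cross e0 e2
  r2 : 0 < cross e2 e3 + cross e1 e3
  r3 : 0 < cross e3 e4 + cross e2 e4
  r4 : 0 < cross e4 e5 + cross e3 e5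
  r5 : 0 < cross e5 e0 + cross e4 e0
  h0 : cross e5 e1 * W < 6 * (cross e5 e0 * cross e0 e1)
  h1 : cross e0 e2 * W < 6 * (cross e0 e1 * cross e1 e2)
  h2 : cross e1 e3 * W < 6 * (cross e1 e2 * cross e2 e3)
  h3 : cross e2 e4 * W < 6 * (cross e2 e3 * cross e3 e4)
  h4 : cross e3 e5 * W < 6 * (cross e3 e4 * cross e4 e5)
  h5 : cross e4 e0 * W < 6 * (cross e4 e5 * cross e5 e0)

namespace LargeEars

variable {e0 e1 e2 e3 e4 e5 : ℝ × ℝ} {W : ℝ}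

lemma rotate (H : LargeEars e0 e1 e2 e3 e4 e5 W) : LargeEars e1 e2 e3 e4 e5 e0 W := by
  obtain ⟨hs, ha, hp, c0, c1, c2, c3, c4, c5, l0, l1, l2, l3, l4, l5, r0, r1, r2, r3, r4, r5,
    h0, h1, h2, h3, h4, h5⟩ := H
  refine ⟨by rw [← hs]; abel, ?_, hp, c1, c2, c3, c4, c5, c0, l1, l2, l3, l4, l5, l0,
    r1, r2, r3, r4, r5, r0, h1, h2, h3, h4, h5, h0⟩
  obtain rfl : e5 = -(e0 + e1 + e2 + e3 + e4) := by
    rw [eq_neg_iff_add_eq_zero, ← hs]; abel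
  rw [ha]
  simp only [cross, Prod.fst_neg, Prod.snd_neg, Prod.fst_add, Prod.snd_add]; ring

lemma false_of_alternating (H : LargeEars e0 e1 e2 e3 e4 e5 W) (k0 : 0 < cross e5 e1)
    (k2 : 0 < cross e1 e3) (k4 : 0 < cross e3 e5) : False := by
  have m2 := sum_relation H.sum
  have m3 := sum_relation H.rotate.rotate.sum
  have r1 := alternating_relation e0 e1 e2 e3 e5
  have r3 := alternating_relation e2 e3 e4 e5 e1
  have r5 := alternating_relation e4 e5 e0 e1 e3
  refine alternating_false k0 k2 k4 H.c0 H.c1 H.c2 H.c3 H.c4 H.c5 H.area_pos r1 r3 r5 rfl m2.symm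
    (m2.trans m3).symm
    (area_relation (f0 := cross e0 e3) (f1 := cross e1 e4) k0 k2 k4 r1 r3 r5 ?_ ?_ rfl m2.symm
      (m2.trans m3).symm ?_) H.h0 H.h1 H.h2 H.h3 H.h4 H.h5
  · simp only [cross]; ring
  · obtain rfl : e5 = -(e0 + e1 + e2 + e3 + e4) := by
      rw [eq_neg_iff_add_eq_zero, ← H.sum]; abel
    simp only [cross, Prod.fst_neg, Prod.snd_neg, Prod.fst_add, Prod.snd_add]; ring
  · rw [cross_swap e0 e4, H.area]; ring

lemma false_of_opposite (H : LargeEars e0 e1 e2 e3 e4 e5 W) (k1 : cross e0 e2 ≤ 0)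
    (k4 : cross e3 e5 ≤ 0) : False := by
  obtain ⟨hs, ha, hp, c0, c1, c2, c3, c4, c5, l0, l1, l2, l3, l4, l5, r0, r1, r2, r3, r4, r5,
    h0, h1, h2, h3, h4, h5⟩ := H
  have key : cross e0 e2 * (cross e3 e4 + cross e3 e5) * (cross e4 e5 + cross e3 e5) =
      cross e2 e3 * (cross e0 e1 + cross e0 e2) * (cross e4 e5 + cross e3 e5)
      - cross e3 e5 * (cross e0 e1 + cross e0 e2) * (cross e1 e2 + cross e0 e2)
      + cross e5 e0 * (cross e1 e2 + cross e0 e2) * (cross e3 e4 + cross e3 e5) := by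
    obtain rfl : e4 = -(e0 + e1 + e2 + e3 + e5) := by
      rw [eq_neg_iff_add_eq_zero, ← hs]; abel
    simp only [cross, Prod.fst_neg, Prod.snd_neg, Prod.fst_add, Prod.snd_add]; ring
  have t1 := mul_nonneg (neg_nonneg.2 k1) (mul_pos l4 r4).le
  have t2 := mul_pos c3 (mul_pos l1 r4)
  have t3 := mul_nonneg (neg_nonneg.2 k4) (mul_pos l1 r1).le
  have t4 := mul_pos c0 (mul_pos r1 l4)
  linarith

end LargeEars

lemma adjacent_aux {ξ η : ℝ} (hξ : 0 < ξ) (hη : 0 < η) (h : ξ + η < 1) (hle : ξ ≤ η) :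
    6 * ξ * (1 - ξ - η) < (1 - ξ) * (2 - ξ - η) := by
  have h1 := mul_nonneg (sub_nonneg.2 hle) (by linarith : 0 ≤ 1 - ξ - η)
  have h2 := mul_nonneg (sub_nonneg.2 hle) (by linarith : 0 ≤ 2 - ξ - η)
  nlinarith [sq_nonneg (7 * (ξ + η) - 5)]

lemma adjacent_false {g s t c0 c4 c5 k4 k5 W : ℝ} (hg : 0 < g) (c0_pos : 0 < c0)
    (c4_pos : 0 < c4) (c5_pos : 0 < c5) (k4_pos : 0 < k4) (k5_pos : 0 < k5)
    (hs : s * g = c4 + k4) (ht : t * g = k5 + c0) (hc : c5 * g = k4 * k5 - c0 * c4)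
    (hW : 2 * ((1 + s) * (1 + t) * g) - s * c0 - t * c4 ≤ W)
    (h4 : k4 * W < 6 * (c4 * c5)) (h5 : k5 * W < 6 * (c5 * c0)) : False := by
  have s_pos : 0 < s := pos_of_mul_pos_left (by linarith : 0 < s * g) hg.le
  have t_pos : 0 < t := pos_of_mul_pos_left (by linarith : 0 < t * g) hg.le
  obtain ⟨ξ, rfl⟩ : ∃ ξ, c4 = s * g * ξ := ⟨c4 / (s * g), by field_simp⟩
  obtain ⟨η, rfl⟩ : ∃ η, c0 = t * g * η := ⟨c0 / (t * g), by field_simp⟩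
  obtain rfl : k4 = s * g * (1 - ξ) := by linarith
  obtain rfl : k5 = t * g * (1 - η) := by linarith
  obtain rfl : c5 = s * t * g * (1 - ξ - η) := by
    apply mul_right_cancel₀ hg.ne'; linear_combination hc
  have hsg := mul_pos s_pos hg
  have htg := mul_pos t_pos hg
  have hstg : 0 < s * t * g := by positivity
  have ξ_pos : 0 < ξ := pos_of_mul_pos_right c4_pos hsg.le
  have η_pos : 0 < η := pos_of_mul_pos_right c0_pos htg.le
  have hξ : 0 < 1 - ξ := pos_of_mul_pos_right k4_pos hsg.le
  have hη : 0 < 1 - η := pos_of_mul_pos_right k5_pos htg.le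
  have hσ : 0 < 1 - ξ - η := pos_of_mul_pos_right c5_pos hstg.le
  have hW1 : s * t * g * (2 - ξ - η) ≤ W := by linarith
  rcases le_total ξ η with h | h
  · have := mul_le_mul_of_nonneg_left hW1 k4_pos.le
    have := mul_lt_mul_of_pos_left (adjacent_aux ξ_pos η_pos (by linarith) h)
      (mul_pos hstg hsg)
    linarith
  · have := mul_le_mul_of_nonneg_left hW1 k5_pos.le
    have := mul_lt_mul_of_pos_left (adjacent_aux η_pos ξ_pos (by linarith) h)
      (mul_pos hstg htg)
    linarith

namespace LargeEars

variable {e0 e1 e2 e3 e4 e5 : ℝ × ℝ} {W : ℝ}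

lemma false_of_adjacent (H : LargeEars e0 e1 e2 e3 e4 e5 W) (k1 : cross e0 e2 ≤ 0)
    (k2 : cross e1 e3 ≤ 0) : False := by
  have k4 : 0 < cross e3 e5 := by
    by_contra h
    exact H.false_of_opposite k1 (not_lt.1 h)
  have k5 : 0 < cross e4 e0 := by
    by_contra h
    exact H.rotate.false_of_opposite k2 (not_lt.1 h)
  have pl := plucker e0 e1 e2 e3
  have hg : 0 < cross e3 e0 := by
    have h1 : 0 < cross e0 e1 * cross e2 e3 - cross e0 e2 * cross e1 e3 := by
      linarith [mul_pos H.l1 H.c3, mul_nonneg (neg_nonneg.2 k1) H.r2.le]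
    rw [cross_swap e3 e0] at pl
    exact pos_of_mul_pos_left (by linarith : 0 < cross e3 e0 * cross e1 e2) H.c2.le
  obtain ⟨s, hs⟩ : ∃ s, s * cross e3 e0 = cross e3 e4 + cross e3 e5 :=
    ⟨(cross e3 e4 + cross e3 e5) / cross e3 e0, by field_simp⟩
  obtain ⟨t, ht⟩ : ∃ t, t * cross e3 e0 = cross e4 e0 + cross e5 e0 :=
    ⟨(cross e4 e0 + cross e5 e0) / cross e3 e0, by field_simp⟩
  have s_pos : 0 < s := pos_of_mul_pos_left (by linarith [H.l4] : 0 < s * cross e3 e0) hg.le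
  have t_pos : 0 < t := pos_of_mul_pos_left (by linarith [H.r5] : 0 < t * cross e3 e0) hg.le
  have hk1 : cross e0 e2 = (1 + t) * cross e3 e0 - cross e0 e1 := by
    have : cross e0 e2 = cross e3 e0 + (cross e4 e0 + cross e5 e0) - cross e0 e1 := by
      obtain rfl : e5 = -(e0 + e1 + e2 + e3 + e4) := by
        rw [eq_neg_iff_add_eq_zero, ← H.sum]; abel
      simp only [cross, Prod.fst_neg, Prod.snd_neg, Prod.fst_add, Prod.snd_add]; ring
    rw [this, ← ht]; ring
  have hk2 : cross e1 e3 = (1 + s) * cross e3 e0 - cross e2 e3 := by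
    have : cross e1 e3 = cross e3 e0 + (cross e3 e4 + cross e3 e5) - cross e2 e3 := by
      obtain rfl : e5 = -(e0 + e1 + e2 + e3 + e4) := by
        rw [eq_neg_iff_add_eq_zero, ← H.sum]; abel
      simp only [cross, Prod.fst_neg, Prod.snd_neg, Prod.fst_add, Prod.snd_add]; ring
    rw [this, ← hs]; ring
  have hc2 : cross e1 e2 = (1 + s) * cross e0 e1 + (1 + t) * cross e2 e3
      - (1 + s) * (1 + t) * cross e3 e0 := by
    apply mul_right_cancel₀ hg.ne'
    rw [cross_swap e3 e0, hk1, hk2] at pl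
    linarith
  have hc5 : cross e4 e5 * cross e3 e0 = cross e3 e5 * cross e4 e0 - cross e5 e0 * cross e3 e4 := by
    simp only [cross]; ring
  refine adjacent_false hg H.c0 H.c4 H.c5 k4 k5 hs ht hc5 ?_ H.h4 H.h5
  have hW : W = cross e1 e2 + (1 + s) * (1 + t) * cross e3 e0 - s * cross e5 e0
      - t * cross e3 e4 := by
    apply mul_right_cancel₀ hg.ne'
    have : (cross e1 e2 + (1 + s) * (1 + t) * cross e3 e0 - s * cross e5 e0
      - t * cross e3 e4) * cross e3 e0 = cross e1 e2 * cross e3 e0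
        + (cross e3 e0 + cross e3 e4 + cross e3 e5) * (cross e3 e0 + cross e4 e0 + cross e5 e0)
        - (cross e3 e4 + cross e3 e5) * cross e5 e0
        - (cross e4 e0 + cross e5 e0) * cross e3 e4 := by
      rw [add_assoc (cross e3 e0), add_assoc (cross e3 e0), ← hs, ← ht]; ring
    rw [this, H.area]
    obtain rfl : e5 = -(e0 + e1 + e2 + e3 + e4) := by
      rw [eq_neg_iff_add_eq_zero, ← H.sum]; abel
    simp only [cross, Prod.fst_neg, Prod.snd_neg, Prod.fst_add, Prod.snd_add]; ring
  have t1 : 0 ≤ (1 + s) * (cross e0 e1 - (1 + t) * cross e3 e0) :=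
    mul_nonneg (by linarith) (by linarith)
  have t2 : 0 ≤ (1 + t) * (cross e2 e3 - (1 + s) * cross e3 e0) :=
    mul_nonneg (by linarith) (by linarith)
  linarith

theorem elim (H : LargeEars e0 e1 e2 e3 e4 e5 W) : False := by
  have adj : ∀ {e0 e1 e2 e3 e4 e5 : ℝ × ℝ}, LargeEars e0 e1 e2 e3 e4 e5 W →
      cross e0 e2 ≤ 0 → (0 < cross e5 e1 ∧ 0 < cross e1 e3 ∧ 0 < cross e3 e5) := by
    intro e0 e1 e2 e3 e4 e5 H k1
    refine ⟨?_, ?_, ?_⟩ <;> by_contra h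
    · exact H.rotate.rotate.rotate.rotate.rotate.false_of_adjacent (not_lt.1 h) k1
    · exact H.false_of_adjacent k1 (not_lt.1 h)
    · exact H.false_of_opposite k1 (not_lt.1 h)
  by_cases h1 : cross e0 e2 ≤ 0
  · obtain ⟨a, b, c⟩ := adj H h1
    exact H.false_of_alternating a b c
  by_cases h3 : cross e2 e4 ≤ 0
  · obtain ⟨a, b, c⟩ := adj H.rotate.rotate h3
    exact H.false_of_alternating c a b
  by_cases h5 : cross e4 e0 ≤ 0
  · obtain ⟨a, b, c⟩ := adj H.rotate.rotate.rotate.rotate h5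
    exact H.false_of_alternating b c a
  exact H.rotate.false_of_alternating (not_le.1 h1) (not_le.1 h3) (not_le.1 h5)

end LargeEars

/-- The doubled signed area of the triangle `p q r`. -/
def orient (p q r : ℝ × ℝ) : ℝ := cross (q - p) (r - p)

/-- Six points in convex position, listed counterclockwise. -/
def ConvexPos (p : Fin 6 → ℝ × ℝ) : Prop :=
  ∀ i j k, i < j → j < k → 0 < orient (p i) (p j) (p k)

/-- The doubled area of the hexagon with vertices `p`. -/
def hexArea (p : Fin 6 → ℝ × ℝ) : ℝ := ∑ i, cross (p i) (p (i + 1))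

lemma orient_rotate (p q r : ℝ × ℝ) : orient q r p = orient p q r := by
  simp only [orient, cross, Prod.fst_sub, Prod.snd_sub]; ring

lemma cross_add_left (u v w : ℝ × ℝ) : cross (u + v) w = cross u w + cross v w := by
  simp only [cross, Prod.fst_add, Prod.snd_add]; ring

lemma cross_add_right (u v w : ℝ × ℝ) : cross u (v + w) = cross u v + cross u w := by
  simp only [cross, Prod.fst_add, Prod.snd_add]; ring

lemma orient_eq (p q r : ℝ × ℝ) : orient p q r = cross (q - p) (r - q) := by
  simp only [orient, cross, Prod.fst_sub, Prod.snd_sub]; ring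

lemma hexArea_rotate (p : Fin 6 → ℝ × ℝ) (n : Fin 6) :
    hexArea (fun i => p (i + n)) = hexArea p := by
  simp only [hexArea]
  rw [← Equiv.sum_comp (Equiv.addRight n) (fun i => cross (p i) (p (i + 1)))]
  simp only [Equiv.coe_addRight, add_right_comm]

lemma hexArea_eq (p : Fin 6 → ℝ × ℝ) :
    hexArea p = orient (p 0) (p 1) (p 2) + orient (p 0) (p 2) (p 3) + orient (p 0) (p 3) (p 4)
      + orient (p 0) (p 4) (p 5) := by
  simp [hexArea, orient, cross, Fin.sum_univ_succ, -Fin.isValue]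
  ring

namespace ConvexPos

variable {p : Fin 6 → ℝ × ℝ}

lemma rotate (hp : ConvexPos p) (n : Fin 6) : ConvexPos (fun i => p (i + n)) := by
  intro i j k hij hjk
  have key : ∀ i j k n : Fin 6, i < j → j < k →
      (i + n < j + n ∧ j + n < k + n) ∨ (j + n < k + n ∧ k + n < i + n) ∨
        (k + n < i + n ∧ i + n < j + n) := by decide
  rcases key i j k n hij hjk with ⟨h1, h2⟩ | ⟨h1, h2⟩ | ⟨h1, h2⟩
  · exact hp _ _ _ h1 h2
  · rw [← orient_rotate]; exact hp _ _ _ h1 h2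
  · rw [← orient_rotate, ← orient_rotate]; exact hp _ _ _ h1 h2

lemma hexArea_pos (hp : ConvexPos p) : 0 < hexArea p := by
  rw [hexArea_eq]
  linarith [hp 0 1 2 (by decide) (by decide), hp 0 2 3 (by decide) (by decide),
    hp 0 3 4 (by decide) (by decide), hp 0 4 5 (by decide) (by decide)]

/-- After a suitable rotation, the ear over the side `p 1`, `p 2` has at most a sixth of the
area. -/
lemma exists_small_ear (hp : ConvexPos p) : ∃ n : Fin 6, ∃ q : Fin 6 → ℝ × ℝ,
    q = (fun i => p (i + n)) ∧ 0 < cross (q 1 - q 0) (q 3 - q 2) ∧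
    6 * (cross (q 1 - q 0) (q 2 - q 1) * cross (q 2 - q 1) (q 3 - q 2))
      ≤ cross (q 1 - q 0) (q 3 - q 2) * hexArea q := by
  by_contra hcon
  push Not at hcon
  have hW := hp.hexArea_pos
  have c {i j k : Fin 6} (h : (i < j ∧ j < k) ∨ (j < k ∧ k < i) ∨ (k < i ∧ i < j)) :
      0 < cross (p j - p i) (p k - p j) := by
    rw [← orient_eq]
    rcases h with ⟨h1, h2⟩ | ⟨h1, h2⟩ | ⟨h1, h2⟩
    · exact hp _ _ _ h1 h2
    · rw [← orient_rotate]; exact hp _ _ _ h1 h2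
    · rw [← orient_rotate, ← orient_rotate]; exact hp _ _ _ h1 h2
  have l {i j m k : Fin 6} (h : (i < j ∧ j < k) ∨ (j < k ∧ k < i) ∨ (k < i ∧ i < j)) :
      0 < cross (p j - p i) (p m - p j) + cross (p j - p i) (p k - p m) := by
    rw [← cross_add_right, sub_add_sub_cancel']; exact c h
  have r {i j m k : Fin 6} (h : (i < m ∧ m < k) ∨ (m < k ∧ k < i) ∨ (k < i ∧ i < m)) :
      0 < cross (p m - p j) (p k - p m) + cross (p j - p i) (p k - p m) := by
    rw [← cross_add_left, sub_add_sub_cancel]; exact c h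
  have H (n : Fin 6) : cross (p (1 + n) - p (0 + n)) (p (3 + n) - p (2 + n)) * hexArea p <
      6 * (cross (p (1 + n) - p (0 + n)) (p (2 + n) - p (1 + n)) *
        cross (p (2 + n) - p (1 + n)) (p (3 + n) - p (2 + n))) := by
    rcases lt_or_ge 0 (cross (p (1 + n) - p (0 + n)) (p (3 + n) - p (2 + n))) with h | h
    · have := hcon n _ rfl h
      rwa [hexArea_rotate] at this
    · refine (mul_nonpos_of_nonpos_of_nonneg h hW.le).trans_lt ?_
      have h1 := hp.rotate n 0 1 2 (by decide) (by decide)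
      have h2 := hp.rotate n 1 2 3 (by decide) (by decide)
      rw [orient_eq] at h1 h2
      positivity
  apply LargeEars.elim (e0 := p 1 - p 0) (e1 := p 2 - p 1) (e2 := p 3 - p 2) (e3 := p 4 - p 3)
    (e4 := p 5 - p 4) (e5 := p 0 - p 5) (W := hexArea p)
  constructor
  · abel
  · rw [hexArea_eq]; simp only [orient, cross, Prod.fst_sub, Prod.snd_sub]; ring
  · exact hW
  iterate 6 exact c (by decide)
  iterate 6 exact l (by decide)
  iterate 6 exact r (by decide)
  exacts [H 5, H 0, H 1, H 2, H 3, H 4]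

end ConvexPos

lemma mem_convexHull_of_eq {s : Set (ℝ × ℝ)} {o u v x : ℝ × ℝ} (ho : o ∈ s) (hu : u ∈ s)
    (hv : v ∈ s) {a b : ℝ} (ha : 0 ≤ a) (hb : 0 ≤ b) (hab : a + b ≤ 1)
    (h : x - o = a • (u - o) + b • (v - o)) : x ∈ convexHull ℝ s := by
  have hx : x = (1 - a - b) • o + a • u + b • v := by
    rw [← sub_eq_zero, ← sub_eq_zero.2 h]; module
  have hs := convex_convexHull ℝ s
  have hsum := hs.sum_mem (t := Finset.univ) (w := ![1 - a - b, a, b]) (z := ![o, u, v])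
    (by intro i _; fin_cases i <;> simp <;> linarith) (by simp [Fin.sum_univ_succ])
    (by
      intro i _
      fin_cases i
      exacts [subset_convexHull ℝ s ho, subset_convexHull ℝ s hu, subset_convexHull ℝ s hv])
  rw [hx]
  simpa [Fin.sum_univ_succ, add_assoc] using hsum

lemma orient_pos_of_notMem {s : Set (ℝ × ℝ)} {o x y z : ℝ × ℝ} (ho : o ∈ s) (hx : x ∈ s)
    (hz : z ∈ s) (hy : y ∉ convexHull ℝ s) (hxy : 0 < orient o x y) (hyz : 0 < orient o y z)
    (hxz : 0 < orient o x z) : 0 < orient x y z := by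
  by_contra! hneg
  have key : orient x y z = orient o x y + orient o y z - orient o x z := by
    simp only [orient, cross, Prod.fst_sub, Prod.snd_sub]; ring
  refine hy (mem_convexHull_of_eq ho hx hz (a := orient o y z / orient o x z)
    (b := orient o x y / orient o x z) (by positivity) (by positivity) ?_ ?_)
  · rw [← add_div, div_le_one hxz]; linarith
  · ext <;> simp only [Prod.fst_add, Prod.snd_add, Prod.smul_fst, Prod.smul_snd, smul_eq_mul] <;>
      field_simp <;> simp only [orient, cross, Prod.fst_sub, Prod.snd_sub] <;> ring

/-- Sorting the other points by the slope seen from a fixed vertex. -/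
lemma exists_slope {S : Finset (ℝ × ℝ)} {o : ℝ × ℝ}
    (h : ∀ x ∈ S, x ∉ convexHull ℝ (S.erase x : Set (ℝ × ℝ))) (ho : o ∈ S) :
    ∃ key : ℝ × ℝ → ℝ, Set.InjOn key (S.erase o) ∧
      ∀ x ∈ S.erase o, ∀ y ∈ S.erase o, key x < key y → 0 < orient o x y := by
  obtain ⟨f, u, hfo, hf⟩ := geometric_hahn_banach_point_closed (convex_convexHull ℝ _)
    ((S.erase o).finite_toSet.isClosed_convexHull ℝ) (h o ho)
  have hlin (x : ℝ × ℝ) : f x = f (1, 0) * x.1 + f (0, 1) * x.2 := by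
    conv_lhs => rw [show x = x.1 • ((1, 0) : ℝ × ℝ) + x.2 • ((0, 1) : ℝ × ℝ) by ext <;> simp]
    rw [map_add, map_smul, map_smul, smul_eq_mul, smul_eq_mul]; ring
  generalize f (1, 0) = A at hlin
  generalize f (0, 1) = B at hlin
  set D : ℝ × ℝ → ℝ := fun x => A * (x.1 - o.1) + B * (x.2 - o.2) with hD
  set N : ℝ × ℝ → ℝ := fun x => A * (x.2 - o.2) - B * (x.1 - o.1) with hN
  have D_pos {x} (hx : x ∈ S.erase o) : 0 < D x := by
    have := hfo.trans (hf x (subset_convexHull ℝ _ hx))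
    rw [hlin, hlin x] at this
    simp only [hD]; linarith
  have key (x y : ℝ × ℝ) : orient o x y * (A ^ 2 + B ^ 2) = D x * N y - N x * D y := by
    simp only [hD, hN, orient, cross, Prod.fst_sub, Prod.snd_sub]; ring
  have ray {x y} (hx : x ∈ S.erase o) (hy : y ∈ S.erase o) (hxy : N x / D x = N y / D y)
      (hle : D x ≤ D y) : x = y := by
    by_contra hne
    have hx0 := D_pos hx
    have hy0 := D_pos hy
    have hAB : 0 < A ^ 2 + B ^ 2 := by
      by_contra! hc
      have hA : A = 0 := by nlinarith
      have hB : B = 0 := by nlinarith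
      simp [hD, hA, hB] at hx0
    rw [div_eq_div_iff hx0.ne' hy0.ne'] at hxy
    rw [Finset.mem_erase] at hx hy
    have hyS : y ∈ (S.erase x : Set (ℝ × ℝ)) := by simpa using ⟨hy.2, Ne.symm hne⟩
    refine h x hx.2 (mem_convexHull_of_eq (o := o) (u := y) (v := y) (a := D x / D y) (b := 0)
      (by simpa using ⟨ho, Ne.symm hx.1⟩) hyS hyS
      (by positivity) le_rfl (by rwa [add_zero, div_le_one hy0]) ?_)
    have horient : orient o x y = 0 := by
      have := key x y
      rw [hxy] at this
      apply (mul_eq_zero.1 (this.trans (by ring))).resolve_right hAB.ne'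
    simp only [orient, cross, Prod.fst_sub, Prod.snd_sub] at horient
    ext <;> simp only [Prod.fst_add, Prod.snd_add, Prod.smul_fst, Prod.smul_snd, smul_eq_mul,
      Prod.fst_sub, Prod.snd_sub] <;> field_simp <;> simp only [hD]
    · linear_combination B * horient
    · linear_combination -A * horient
  refine ⟨fun x => N x / D x, ?_, ?_⟩
  · intro x hx y hy hxy
    rcases le_total (D x) (D y) with hle | hle
    · exact ray hx hy hxy hle
    · exact (ray hy hx hxy.symm hle).symm
  · intro x hx y hy hxy
    rw [div_lt_div_iff₀ (D_pos hx) (D_pos hy)] at hxy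
    have := key x y
    by_contra! hc
    nlinarith [mul_nonpos_of_nonpos_of_nonneg hc (by positivity : 0 ≤ A ^ 2 + B ^ 2)]

lemma exists_convexPos {S : Finset (ℝ × ℝ)} (hS : S.card = 6)
    (h : ∀ x ∈ S, x ∉ convexHull ℝ (S.erase x : Set (ℝ × ℝ))) :
    ∃ p : Fin 6 → ℝ × ℝ, ConvexPos p ∧ Set.range p = S := by
  obtain ⟨o, ho⟩ := Finset.card_pos.1 (by omega : 0 < S.card)
  obtain ⟨key, key_inj, hkey⟩ := exists_slope h ho
  have hcard : ((S.erase o).image key).card = 5 := by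
    rw [Finset.card_image_of_injOn key_inj, Finset.card_erase_of_mem ho, hS]
  set e := ((S.erase o).image key).orderEmbOfFin hcard with he
  have hmem (i) : ∃ x ∈ S.erase o, key x = e i :=
    Finset.mem_image.1 (Finset.orderEmbOfFin_mem _ hcard i)
  choose g gmem hg using hmem
  have gS (i) : g i ∈ S := Finset.mem_of_mem_erase (gmem i)
  have g_lt {i j : Fin 5} (hij : i < j) : 0 < orient o (g i) (g j) := by
    apply hkey _ (gmem i) _ (gmem j)
    rw [hg, hg]; exact e.strictMono hij
  have g_inj {i j : Fin 5} (hij : i < j) : g i ≠ g j := by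
    intro heq
    have := e.strictMono hij
    rw [← hg, ← hg, heq] at this
    exact this.false
  refine ⟨Fin.cons o g, ?_, ?_⟩
  · intro i j k hij hjk
    obtain ⟨j, rfl⟩ := Fin.exists_succ_eq.2 (Fin.ne_zero_of_lt hij)
    obtain ⟨k, rfl⟩ := Fin.exists_succ_eq.2 (Fin.ne_zero_of_lt hjk)
    rw [Fin.succ_lt_succ_iff] at hjk
    induction i using Fin.cases with
    | zero => simpa using g_lt hjk
    | succ i =>
      rw [Fin.succ_lt_succ_iff] at hij
      simp only [Fin.cons_succ]
      refine orient_pos_of_notMem (s := S.erase (g j)) (o := o) ?_ ?_ ?_ (h _ (gS j)) (g_lt hij)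
        (g_lt hjk) (g_lt (hij.trans hjk))
      · simpa using ⟨ho, (Finset.ne_of_mem_erase (gmem j)).symm⟩
      · simpa using ⟨gS i, g_inj hij⟩
      · simpa using ⟨gS k, (g_inj hjk).symm⟩
  · rw [Fin.range_cons]
    refine Set.Subset.antisymm (Set.insert_subset ho ?_) fun x hx => ?_
    · rintro _ ⟨i, rfl⟩; exact gS i
    · rcases eq_or_ne x o with rfl | hxo
      · exact Set.mem_insert _ _
      · have hxe : x ∈ S.erase o := Finset.mem_erase.2 ⟨hxo, hx⟩
        have hk : key x ∈ Set.range e := by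
          rw [he, Finset.range_orderEmbOfFin]
          exact Finset.mem_image_of_mem key hxe
        obtain ⟨i, hi⟩ := hk
        exact Set.mem_insert_of_mem _ ⟨i, key_inj (gmem i) hxe ((hg i).trans hi)⟩

lemma cross_smul_left (a : ℝ) (u v : ℝ × ℝ) : cross (a • u) v = a * cross u v := by
  simp only [cross, Prod.smul_fst, Prod.smul_snd, smul_eq_mul]; ring

lemma cross_same (u : ℝ × ℝ) : cross u u = 0 := by
  simp only [cross]; ring

/-- The linear map sending the standard basis to `u`, `v`. -/
def pairMap (u v : ℝ × ℝ) : ℝ × ℝ →ₗ[ℝ] ℝ × ℝ :=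
  (LinearMap.fst ℝ ℝ ℝ).smulRight u + (LinearMap.snd ℝ ℝ ℝ).smulRight v

lemma det_pairMap (u v : ℝ × ℝ) : LinearMap.det (pairMap u v) = cross u v := by
  rw [← LinearMap.det_toMatrix (Module.Basis.finTwoProd ℝ), Matrix.det_fin_two]
  simp [LinearMap.toMatrix_apply, pairMap, cross]
  ring

/-- The standard triangle, without one of its sides. -/
def stdTriangle : Set (ℝ × ℝ) := {t | 0 < t.1 ∧ 0 ≤ t.2 ∧ t.1 + t.2 ≤ 1}

/-- The triangle `o`, `o + u`, `o + v`, without the side from `o` to `o + v`. -/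
def triangle (o u v : ℝ × ℝ) : Set (ℝ × ℝ) := (fun x => o + x) '' (pairMap u v '' stdTriangle)

lemma mem_triangle {o u v x : ℝ × ℝ} : x ∈ triangle o u v ↔
    ∃ a b : ℝ, 0 < a ∧ 0 ≤ b ∧ a + b ≤ 1 ∧ x = o + (a • u + b • v) := by
  constructor
  · rintro ⟨_, ⟨⟨a, b⟩, ⟨h1, h2, h3⟩, rfl⟩, rfl⟩; exact ⟨a, b, h1, h2, h3, rfl⟩
  · rintro ⟨a, b, h1, h2, h3, rfl⟩; exact ⟨_, ⟨(a, b), ⟨h1, h2, h3⟩, rfl⟩, rfl⟩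

lemma convex_stdTriangle : Convex ℝ stdTriangle := by
  have h1 : Convex ℝ {t : ℝ × ℝ | 0 < t.1} := convex_halfSpace_gt (LinearMap.fst ℝ ℝ ℝ).isLinear 0
  have h2 : Convex ℝ {t : ℝ × ℝ | 0 ≤ t.2} := convex_halfSpace_ge (LinearMap.snd ℝ ℝ ℝ).isLinear 0
  have h3 : Convex ℝ {t : ℝ × ℝ | t.1 + t.2 ≤ 1} :=
    convex_halfSpace_le (LinearMap.fst ℝ ℝ ℝ + LinearMap.snd ℝ ℝ ℝ).isLinear 1
  exact h1.inter (h2.inter h3)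

lemma nullMeasurableSet_triangle (o u v : ℝ × ℝ) : NullMeasurableSet (triangle o u v) :=
  ((convex_stdTriangle.linear_image _).translate o).nullMeasurableSet volume

lemma volume_triangle (o u v : ℝ × ℝ) :
    volume (triangle o u v) = ENNReal.ofReal |cross u v| * volume stdTriangle := by
  rw [triangle, Set.image_add_left, measure_preimage_add, Measure.addHaar_image_linearMap,
    det_pairMap]

/-- A fan of triangles fills out at most the convex hull. -/
lemma hexArea_le_volume {p : Fin 6 → ℝ × ℝ} (hp : ConvexPos p) :
    ENNReal.ofReal (hexArea p) * volume stdTriangle ≤ volume (convexHull ℝ (Set.range p)) := by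
  set u : Fin 5 → ℝ × ℝ := fun i => p i.succ - p 0 with hu
  have hcross {i j : Fin 5} (hij : i < j) : 0 < cross (u i) (u j) :=
    hp 0 i.succ j.succ i.succ_pos (Fin.succ_lt_succ_iff.2 hij)
  have hcross_nonneg {i j : Fin 5} (hij : i ≤ j) : cross (u j) (u i) ≤ 0 := by
    rcases hij.eq_or_lt with rfl | hij
    · rw [cross_same]
    · rw [cross_swap]; linarith [hcross hij]
  set T : Fin 4 → Set (ℝ × ℝ) := fun i => triangle (p 0) (u i.castSucc) (u i.succ) with hT
  have hdisj_lt {i j : Fin 4} (hij : i < j) : Disjoint (T i) (T j) := by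
    rw [Set.disjoint_left]
    intro x hi hj
    obtain ⟨a, b, ha, -, -, rfl⟩ := mem_triangle.1 hi
    obtain ⟨a', b', ha', hb', -, hx⟩ := mem_triangle.1 hj
    have := congrArg (fun x => cross x (u i.succ)) (add_left_cancel hx)
    simp only [cross_add_left, cross_smul_left, cross_same] at this
    have h1 := mul_pos ha (hcross i.castSucc_lt_succ)
    have h2 := mul_nonpos_of_nonneg_of_nonpos ha'.le
      (hcross_nonneg (i := i.succ) (j := j.castSucc) (Fin.succ_le_castSucc_iff.2 hij))
    have h3 := mul_nonpos_of_nonneg_of_nonpos hb'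
      (hcross_nonneg (i := i.succ) (j := j.succ) (Fin.succ_le_succ_iff.2 hij.le))
    linarith
  have hdisj : Pairwise (Function.onFun (AEDisjoint volume) T) := by
    intro i j hij
    rcases hij.lt_or_gt with h | h
    · exact (hdisj_lt h).aedisjoint
    · exact (hdisj_lt h).symm.aedisjoint
  have hsub : ⋃ i, T i ⊆ convexHull ℝ (Set.range p) := by
    refine Set.iUnion_subset fun i x hx => ?_
    obtain ⟨a, b, ha, hb, hab, rfl⟩ := mem_triangle.1 hx
    exact mem_convexHull_of_eq (Set.mem_range_self 0) (Set.mem_range_self i.castSucc.succ)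
      (Set.mem_range_self i.succ.succ) ha.le hb hab (add_sub_cancel_left _ _)
  refine le_trans (le_of_eq ?_) (measure_mono hsub)
  rw [measure_iUnion₀ hdisj fun i => nullMeasurableSet_triangle _ _ _, tsum_fintype]
  simp only [hT, volume_triangle]
  rw [← Finset.sum_mul, ← ENNReal.ofReal_sum_of_nonneg fun _ _ => abs_nonneg _]
  congr 2
  simp only [abs_of_pos (hcross (Fin.castSucc_lt_succ))]
  rw [hexArea_eq]
  simp [Fin.sum_univ_succ, hu, orient]
  ring

lemma convexHull_insert_subset {P s : Set (ℝ × ℝ)} {o u v : ℝ × ℝ} (hP : Convex ℝ P)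
    (hs : s.Nonempty) (hsP : s ⊆ P) (ho : o ∈ P) (hv : o + v ∈ P)
    (h : ∀ w ∈ s, ∃ a b : ℝ, a < 0 ∧ 0 ≤ b ∧ a + b ≤ 1 ∧ w = o + (a • u + b • v)) :
    convexHull ℝ (insert (o + u) s) ⊆ P ∪ triangle o u v := by
  have hull : convexHull ℝ s ⊆
      {w | ∃ a b : ℝ, a < 0 ∧ 0 ≤ b ∧ a + b ≤ 1 ∧ w = o + (a • u + b • v)} := by
    refine convexHull_min h ?_
    rintro _ ⟨a, b, ha, hb, hab, rfl⟩ _ ⟨a', b', ha', hb', hab', rfl⟩ r r' hr hr' hrr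
    obtain rfl : r = 1 - r' := by linarith
    refine ⟨(1 - r') * a + r' * a', (1 - r') * b + r' * b', ?_, by positivity, ?_, by module⟩
    · exact (convex_Iio (0 : ℝ)) ha ha' hr hr' (by ring)
    · have := (convex_Iic (1 : ℝ)) hab hab' hr hr' (by ring)
      simp only [smul_eq_mul, Set.mem_Iic] at this
      linarith
  rw [convexHull_insert hs]
  intro x hx
  obtain ⟨_, rfl, w, hw, hx⟩ := mem_convexJoin.1 hx
  obtain ⟨r, t, hr, ht, hrt, rfl⟩ := hx
  obtain ⟨a, b, ha, hb, hab, rfl⟩ := hull hw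
  obtain rfl : r = 1 - t := by linarith
  have ha1 : 0 < 1 - a := by linarith
  rcases lt_or_ge 0 (1 - t + t * a) with hpos | hneg
  · refine Or.inr (mem_triangle.2 ⟨1 - t + t * a, t * b, hpos, by positivity, ?_, by module⟩)
    nlinarith
  · left
    have hy : o + (b / (1 - a)) • v ∈ P := by
      have := hP ho hv (a := 1 - b / (1 - a)) (b := b / (1 - a))
        (sub_nonneg.2 ((div_le_one ha1).2 (by linarith))) (by positivity) (by ring)
      convert this using 1
      module
    have hwP := convexHull_min hsP hP hw
    have := hP hy hwP (a := 1 - (1 - t + t * a) / a) (b := (1 - t + t * a) / a)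
      (sub_nonneg.2 ((div_le_one_of_neg ha).2 (by nlinarith))) (div_nonneg_of_nonpos hneg ha.le)
      (by ring)
    convert this using 1
    have ha0 := ha.ne
    have ha1' := ha1.ne'
    ext <;> simp only [Prod.fst_add, Prod.snd_add, Prod.smul_fst, Prod.smul_snd, smul_eq_mul] <;>
      field_simp <;> ring

/-- Replacing the side from `p 1` to `p 2` by the apex of its ear. -/
lemma exists_pentagon {p : Fin 6 → ℝ × ℝ} (hp : ConvexPos p)
    (hk : 0 < cross (p 1 - p 0) (p 3 - p 2))
    (hW : 6 * (cross (p 1 - p 0) (p 2 - p 1) * cross (p 2 - p 1) (p 3 - p 2))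
      ≤ cross (p 1 - p 0) (p 3 - p 2) * hexArea p) :
    ∃ z, convexHull ℝ (Set.range p) ⊆ convexHull ℝ {z, p 3, p 4, p 5, p 0} ∧
      volume (convexHull ℝ {z, p 3, p 4, p 5, p 0}) ≤
        ENNReal.ofReal (7 / 6) * volume (convexHull ℝ (Set.range p)) := by
  have c1 : 0 < cross (p 1 - p 0) (p 2 - p 1) := by
    rw [← orient_eq]; exact hp 0 1 2 (by decide) (by decide)
  have c2 : 0 < cross (p 2 - p 1) (p 3 - p 2) := by
    rw [← orient_eq]; exact hp 1 2 3 (by decide) (by decide)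
  set α := cross (p 2 - p 1) (p 3 - p 2) / cross (p 1 - p 0) (p 3 - p 2) with hα
  set β := cross (p 1 - p 0) (p 2 - p 1) / cross (p 1 - p 0) (p 3 - p 2) with hβ
  have α_pos : 0 < α := div_pos c2 hk
  have β_pos : 0 < β := div_pos c1 hk
  have he : p 2 - p 1 = α • (p 1 - p 0) + β • (p 3 - p 2) := by
    have := hk.ne'
    ext <;> simp only [Prod.fst_add, Prod.snd_add, Prod.smul_fst, Prod.smul_snd, smul_eq_mul, hα,
      hβ] <;> field_simp <;> simp only [cross, Prod.fst_sub, Prod.snd_sub] <;> ring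
  set P := convexHull ℝ (Set.range p) with hP
  have mem (i) : p i ∈ P := subset_convexHull ℝ _ (Set.mem_range_self i)
  have coord {w : ℝ × ℝ} (h1 : 0 < orient (p 1) (p 2) w) (h2 : 0 ≤ orient (p 0) (p 1) w)
      (h3 : 0 ≤ orient (p 2) (p 3) w) : ∃ a b : ℝ, a < 0 ∧ 0 ≤ b ∧ a + b ≤ 1 ∧
        w = p 1 + (a • α • (p 1 - p 0) + b • (p 2 - p 1)) := by
    have hαc : 0 < α * cross (p 1 - p 0) (p 2 - p 1) := mul_pos α_pos c1
    refine ⟨-(orient (p 1) (p 2) w / (α * cross (p 1 - p 0) (p 2 - p 1))),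
      orient (p 0) (p 1) w / cross (p 1 - p 0) (p 2 - p 1), ?_, div_nonneg h2 c1.le, ?_, ?_⟩
    · exact neg_lt_zero.2 (div_pos h1 hαc)
    · have key : α * orient (p 0) (p 1) w - orient (p 1) (p 2) w + β * orient (p 2) (p 3) w
          = α * cross (p 1 - p 0) (p 2 - p 1) := by
        have e1 := congrArg (fun x => cross x (w - p 1)) he
        have e2 := congrArg (fun x => cross x (p 2 - p 1)) he
        simp only [cross_add_left, cross_smul_left, cross_same] at e1 e2
        have e3 : orient (p 2) (p 3) w = cross (p 3 - p 2) (w - p 1)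
            - cross (p 3 - p 2) (p 2 - p 1) := by
          simp only [orient, cross, Prod.fst_sub, Prod.snd_sub]; ring
        have e4 : orient (p 0) (p 1) w = cross (p 1 - p 0) (w - p 1) := orient_eq _ _ _
        rw [e3, e4, orient]
        linear_combination e2 - e1
      have hβ3 := mul_nonneg β_pos.le h3
      rw [neg_add_eq_sub, ← mul_div_mul_left _ _ α_pos.ne', ← sub_div, div_le_one hαc]
      linarith
    · have := c1.ne'
      have := α_pos.ne'
      rw [smul_smul, orient_eq (p 0)]
      ext <;> simp only [Prod.fst_add, Prod.snd_add, Prod.smul_fst, Prod.smul_snd, smul_eq_mul] <;>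
        field_simp <;> simp only [orient, cross, Prod.fst_sub, Prod.snd_sub] <;> ring
  have zero_left (q r : ℝ × ℝ) : orient q r q = 0 := by
    simp only [orient, cross, Prod.fst_sub, Prod.snd_sub]; ring
  have zero_right (q r : ℝ × ℝ) : orient q r r = 0 := by
    simp only [orient, cross, Prod.fst_sub, Prod.snd_sub]; ring
  have cyc {q r s : ℝ × ℝ} (h : 0 < orient q r s) : 0 < orient r s q := by
    rwa [orient_rotate]
  refine ⟨p 1 + α • (p 1 - p 0), ?_, ?_⟩
  · have sub := subset_convexHull ℝ {p 1 + α • (p 1 - p 0), p 3, p 4, p 5, p 0}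
    refine convexHull_min ?_ (convex_convexHull ℝ _)
    rintro _ ⟨i, rfl⟩
    fin_cases i
    · exact sub (by simp)
    · have h1 : 0 < 1 + α := by linarith
      refine mem_convexHull_of_eq (o := p 0) (u := p 1 + α • (p 1 - p 0))
        (v := p 1 + α • (p 1 - p 0)) (a := 1 / (1 + α)) (b := 0) (by simp) (by simp) (by simp)
        (by positivity) le_rfl (by rw [add_zero, div_le_one h1]; linarith) ?_
      rw [zero_smul, add_zero, show p 1 + α • (p 1 - p 0) - p 0 = (1 + α) • (p 1 - p 0) by module,
        smul_smul, one_div_mul_cancel h1.ne', one_smul]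
      rfl
    · have h1 : 0 < 1 + β := by linarith
      refine mem_convexHull_of_eq (o := p 3) (u := p 1 + α • (p 1 - p 0))
        (v := p 1 + α • (p 1 - p 0)) (a := 1 / (1 + β)) (b := 0) (by simp) (by simp) (by simp)
        (by positivity) le_rfl (by rw [add_zero, div_le_one h1]; linarith) ?_
      have : p 1 + α • (p 1 - p 0) - p 3 = (1 + β) • (p 2 - p 3) := by
        rw [← sub_eq_zero, ← sub_eq_zero.2 he.symm]; module
      rw [zero_smul, add_zero, this, smul_smul, one_div_mul_cancel h1.ne', one_smul]
      rfl
    · exact sub (by simp)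
    · exact sub (by simp)
    · exact sub (by simp)
  · have hQ : convexHull ℝ {p 1 + α • (p 1 - p 0), p 3, p 4, p 5, p 0} ⊆
        P ∪ triangle (p 1) (α • (p 1 - p 0)) (p 2 - p 1) := by
      refine convexHull_insert_subset (convex_convexHull ℝ _) (Set.insert_nonempty _ _) ?_ (mem 1)
        (by simpa using mem 2) ?_
      · simp only [Set.insert_subset_iff, Set.singleton_subset_iff]
        exact ⟨mem 3, mem 4, mem 5, mem 0⟩
      · rintro w (rfl | rfl | rfl | rfl)
        · exact coord (hp 1 2 3 (by decide) (by decide)) (hp 0 1 3 (by decide) (by decide)).le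
            (zero_right _ _).ge
        · exact coord (hp 1 2 4 (by decide) (by decide)) (hp 0 1 4 (by decide) (by decide)).le
            (hp 2 3 4 (by decide) (by decide)).le
        · exact coord (hp 1 2 5 (by decide) (by decide)) (hp 0 1 5 (by decide) (by decide)).le
            (hp 2 3 5 (by decide) (by decide)).le
        · exact coord (cyc (hp 0 1 2 (by decide) (by decide))) (zero_left _ _).ge
            (cyc (hp 0 2 3 (by decide) (by decide))).le
    have hear : |cross (α • (p 1 - p 0)) (p 2 - p 1)| ≤ 1 / 6 * hexArea p := by
      rw [cross_smul_left, abs_of_pos (mul_pos α_pos c1), hα, div_mul_eq_mul_div, div_le_iff₀ hk]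
      linarith
    calc volume (convexHull ℝ {p 1 + α • (p 1 - p 0), p 3, p 4, p 5, p 0})
      _ ≤ volume P + volume (triangle (p 1) (α • (p 1 - p 0)) (p 2 - p 1)) :=
        (measure_mono hQ).trans (measure_union_le _ _)
      _ ≤ volume P + ENNReal.ofReal (1 / 6) * volume P := by
        gcongr
        calc volume (triangle (p 1) (α • (p 1 - p 0)) (p 2 - p 1))
          _ ≤ ENNReal.ofReal (1 / 6 * hexArea p) * volume stdTriangle := by
            rw [volume_triangle]; gcongr
          _ = ENNReal.ofReal (1 / 6) * (ENNReal.ofReal (hexArea p) * volume stdTriangle) := by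
            rw [ENNReal.ofReal_mul (by norm_num), mul_assoc]
          _ ≤ _ := by gcongr; exact hexArea_le_volume hp
      _ = ENNReal.ofReal (7 / 6) * volume P := by
        rw [show (7 / 6 : ℝ) = 1 + 1 / 6 by norm_num, ENNReal.ofReal_add (by norm_num)
          (by norm_num), ENNReal.ofReal_one, add_mul, one_mul]

/-- Every convex hexagon `P` is contained in a convex pentagon `Q`
with `|Q| ≤ (7/6)·|P|`. -/
theorem hexagon_in_small_pentagon (P : Set (ℝ × ℝ)) (hP : IsConvexPolygon 6 P) :
    ∃ Q : Set (ℝ × ℝ), IsConvexPolygon 5 Q ∧ P ⊆ Q ∧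
      volume Q ≤ ENNReal.ofReal (7 / 6) * volume P := by
  obtain ⟨S, hS, rfl, hinterior⟩ := hP
  have hself : volume (convexHull ℝ (S : Set (ℝ × ℝ))) ≤
      ENNReal.ofReal (7 / 6) * volume (convexHull ℝ (S : Set (ℝ × ℝ))) :=
    le_mul_of_one_le_left' (by rw [ENNReal.one_le_ofReal]; norm_num)
  rcases hS.lt_or_eq with hlt | heq
  · exact ⟨_, ⟨S, Nat.le_of_lt_succ hlt, rfl, hinterior⟩, subset_rfl, hself⟩
  by_cases h : ∀ x ∈ S, x ∉ convexHull ℝ (S.erase x : Set (ℝ × ℝ))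
  · obtain ⟨p, hp, hpS⟩ := exists_convexPos heq h
    obtain ⟨n, q, rfl, hk, hW⟩ := hp.exists_small_ear
    obtain ⟨z, hsub, hvol⟩ := exists_pentagon (hp.rotate n) hk hW
    have hrange : Set.range (fun i => p (i + n)) = S :=
      ((Equiv.addRight n).surjective.range_comp p).trans hpS
    rw [hrange] at hsub hvol
    refine ⟨_, ⟨{z, p (3 + n), p (4 + n), p (5 + n), p (0 + n)}, Finset.card_le_five, ?_,
      hinterior.mono (interior_mono hsub)⟩, hsub, hvol⟩
    simp only [Finset.coe_insert, Finset.coe_singleton]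
  · push Not at h
    obtain ⟨x, hx, hmem⟩ := h
    refine ⟨_, ⟨S.erase x, ?_, ?_, hinterior⟩, subset_rfl, hself⟩
    · rw [Finset.card_erase_of_mem hx, heq]
    · refine (convexHull_min (fun y hy => ?_) (convex_convexHull ℝ _)).antisymm
        (convexHull_mono (Finset.erase_subset x S))
      rcases eq_or_ne y x with rfl | hne
      · exact hmem
      · exact subset_convexHull ℝ _ (Finset.mem_erase.2 ⟨hne, hy⟩)
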